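/- arXiv:2411.01462 — 10 statements merged into one kernel-verified Lean document; each statement's English description precedes it below -/
import Mathlib

section
/- For any number of agents with general additive valuations and any matroid (M, F) used as a common constraint, every Max-NSW allocation (one selected by first maximizing the number of agents with positive utility and then maximizing the Nash product over those agents) is a 1/2-EF1 and Pareto optimal feasible allocation. -/
open Finset

/-- Additive valuation of a bundle: sum of item values. -/
def AddVal {ι : Type*} (v : ι → ℝ) (S : Finset ι) : ℝ := ∑ g ∈ S, v g

/-- An independence system: a hereditary family of finite sets containing ∅. -/
def IndepSystem {ι : Type*} (F : Finset ι → Prop) : Prop :=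
  F ∅ ∧ ∀ ⦃C D : Finset ι⦄, C ⊆ D → F D → F C

/-- A matroid: an independence system with the augmentation property. -/
def IsMatroid {ι : Type*} [DecidableEq ι] (F : Finset ι → Prop) : Prop :=
  IndepSystem F ∧
    ∀ ⦃C D : Finset ι⦄, F C → F D → C.card < D.card → ∃ x ∈ D \ C, F (insert x C)

/-- A feasible allocation: pairwise disjoint bundles, each independent. -/
def Feasible {ι : Type*} {n : ℕ} (F : Finset ι → Prop) (X : Fin n → Finset ι) : Prop :=
  (∀ i, F (X i)) ∧ ∀ i j : Fin n, i ≠ j → Disjoint (X i) (X j)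

/-- The set of agents receiving positive utility. -/
noncomputable def posAgents {ι : Type*} {n : ℕ} (v : Fin n → ι → ℝ)
    (X : Fin n → Finset ι) : Finset (Fin n) :=
  Finset.univ.filter (fun i => 0 < AddVal (v i) (X i))

/-- Nash product over the agents with positive utility. -/
noncomputable def NashPos {ι : Type*} {n : ℕ} (v : Fin n → ι → ℝ)
    (X : Fin n → Finset ι) : ℝ :=
  ∏ i ∈ posAgents v X, AddVal (v i) (X i)

/-- A Max-NSW allocation: feasible; maximizes the number of agents with positive
utility; and subject to that maximizes the Nash product over those agents. -/
def MaxNSW {ι : Type*} {n : ℕ} (F : Finset ι → Prop) (v : Fin n → ι → ℝ)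
    (A : Fin n → Finset ι) : Prop :=
  Feasible F A ∧
    (∀ X : Fin n → Finset ι, Feasible F X → (posAgents v X).card ≤ (posAgents v A).card) ∧
    (∀ X : Fin n → Finset ι, Feasible F X → (posAgents v X).card = (posAgents v A).card →
      NashPos v X ≤ NashPos v A)

/-- α-EF1. -/
def EF1 {ι : Type*} [DecidableEq ι] {n : ℕ} (α : ℝ) (v : Fin n → ι → ℝ)
    (X : Fin n → Finset ι) : Prop :=
  ∀ i j : Fin n, ∃ Z ⊆ X j, Z.card ≤ 1 ∧ AddVal (v i) (X i) ≥ α * AddVal (v i) (X j \ Z)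

/-- Pareto optimality. -/
def ParetoOpt {ι : Type*} {n : ℕ} (F : Finset ι → Prop) (v : Fin n → ι → ℝ)
    (A : Fin n → Finset ι) : Prop :=
  ¬ ∃ X : Fin n → Finset ι, Feasible F X ∧
      (∀ i, AddVal (v i) (A i) ≤ AddVal (v i) (X i)) ∧
      ∃ j, AddVal (v j) (A j) < AddVal (v j) (X j)

theorem aux_extend {ι : Type*} [DecidableEq ι] {F : Finset ι → Prop} (hF : IsMatroid F)
    {D : Finset ι} (hD : F D) : ∀ (k : ℕ) (C : Finset ι), F C → C.card + k = D.card →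
    ∃ I, C ⊆ I ∧ I ⊆ C ∪ D ∧ F I ∧ I.card = D.card := by
  intro k
  induction k with
  | zero => intro C hC h; exact ⟨C, Subset.rfl, subset_union_left, hC, by omega⟩
  | succ k ih =>
    intro C hC h
    obtain ⟨x, hx, hxC⟩ := hF.2 hC hD (by omega)
    rw [mem_sdiff] at hx
    obtain ⟨I, h1, h2, h3, h4⟩ := ih (insert x C) hxC (by rw [card_insert_of_notMem hx.2]; omega)
    refine ⟨I, (subset_insert x C).trans h1, fun y hy => ?_, h3, h4⟩
    have := h2 hy
    simp only [mem_union, mem_insert] at this ⊢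
    rcases this with (rfl | h) | h
    · exact Or.inr hx.1
    · exact Or.inl h
    · exact Or.inr h

theorem aux_exchange {ι : Type*} [DecidableEq ι] {F : Finset ι → Prop} (hF : IsMatroid F)
    {S T : Finset ι} (hS : F S) (hT : F T) (hd : Disjoint S T) :
    ∃ σ : ι → Finset ι, (∀ g ∈ T, σ g ⊆ S ∧ F (insert g (S \ σ g))) ∧
      ∀ g ∈ T, ∀ h ∈ T, g ≠ h → Disjoint (σ g) (σ h) := by
  classical
  let K := {g : ι // g ∈ T ∧ ¬ F (insert g S)}
  let N : K → Finset ι := fun g => S.filter (fun s => F (insert g.1 (S \ {s})))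
  have hall : ∀ U : Finset K, U.card ≤ (U.biUnion N).card := by
    intro U
    by_contra hlt
    push Not at hlt
    have hsub : U.biUnion N ⊆ S := by
      intro x hx
      simp only [mem_biUnion] at hx
      obtain ⟨a, _, ha⟩ := hx
      exact (mem_filter.1 ha).1
    have hU : F (U.map (Function.Embedding.subtype _)) := by
      refine hF.1.2 ?_ hT
      intro x hx
      simp only [mem_map] at hx
      obtain ⟨a, _, rfl⟩ := hx
      exact a.2.1
    obtain ⟨x, hx, hxF⟩ := hF.2 (hF.1.2 hsub hS) hU (by rw [card_map]; exact hlt)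
    rw [mem_sdiff] at hx
    obtain ⟨⟨y, hyU, rfl⟩, hxn⟩ : (∃ y ∈ U, y.1 = x) ∧ x ∉ U.biUnion N := by
      refine ⟨?_, hx.2⟩
      have := hx.1
      rw [mem_map] at this
      exact this
    have hyS : y.1 ∉ S := fun h => (disjoint_left.1 hd) h y.2.1
    have hne : U.biUnion N ≠ S := by
      intro h
      rw [h] at hxF
      exact y.2.2 hxF
    have hcard : (U.biUnion N).card < S.card := card_lt_card (hsub.ssubset_of_ne hne)
    have hci : (insert y.1 (U.biUnion N)).card = (U.biUnion N).card + 1 :=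
      card_insert_of_notMem hxn
    obtain ⟨I, h1, h2, h3, h4⟩ := aux_extend hF hS (S.card - (U.biUnion N).card - 1) _ hxF
      (by omega)
    have hyI : y.1 ∈ I := h1 (mem_insert_self _ _)
    have hnsub : ¬ S ⊆ I := by
      intro h
      have : insert y.1 S ⊆ I := insert_subset hyI h
      exact y.2.2 (hF.1.2 this h3)
    obtain ⟨s, hsS, hsI⟩ := not_subset.1 hnsub
    have hI2 : I ⊆ insert y.1 (S \ {s}) := by
      intro z hz
      have h5 := h2 hz
      have hzs : z ≠ s := fun h => hsI (h ▸ hz)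
      simp only [mem_union, mem_insert, mem_sdiff, mem_singleton] at h5 ⊢
      rcases h5 with (h | h) | h
      · exact Or.inl h
      · exact Or.inr ⟨hsub h, hzs⟩
      · exact Or.inr ⟨h, hzs⟩
    have hc2 : (insert y.1 (S \ {s})).card ≤ I.card := by
      rw [h4]
      have := card_insert_le y.1 (S \ {s})
      have h6 := card_sdiff_of_subset (singleton_subset_iff.2 hsS)
      have h7 : 0 < S.card := card_pos.2 ⟨s, hsS⟩
      rw [card_singleton] at h6
      omega
    have heq := eq_of_subset_of_card_le hI2 hc2
    apply hsI
    apply h1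
    apply mem_insert_of_mem
    refine mem_biUnion.2 ⟨y, hyU, mem_filter.2 ⟨hsS, ?_⟩⟩
    rw [← heq]; exact h3
  obtain ⟨f, hfi, hf⟩ := (Finset.all_card_le_biUnion_card_iff_exists_injective N).1 hall
  refine ⟨fun g => if h : g ∈ T ∧ ¬ F (insert g S) then {f ⟨g, h⟩} else ∅, ?_, ?_⟩
  · intro g hg
    by_cases h : g ∈ T ∧ ¬ F (insert g S)
    · have := mem_filter.1 (hf ⟨g, h⟩)
      simp only [dif_pos h]
      exact ⟨singleton_subset_iff.2 this.1, this.2⟩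
    · simp only [dif_neg h, sdiff_empty]
      refine ⟨empty_subset _, ?_⟩
      by_contra h'
      exact h ⟨hg, h'⟩
  · intro g _ h _ hgh
    dsimp only
    split_ifs with h1 h2
    · rw [disjoint_singleton]
      intro he
      exact hgh (congrArg Subtype.val (hfi he))
    all_goals simp

theorem aux_swap {ι : Type*} {n : ℕ} [DecidableEq ι] {F : Finset ι → Prop}
    {A : Fin n → Finset ι} (hA : Feasible F A) {i j : Fin n} (hij : i ≠ j) {P Q : Finset ι}
    (hP : F P) (hQ : F Q) (hd : Disjoint P Q) (hPs : P ⊆ A i ∪ A j) (hQs : Q ⊆ A i ∪ A j) :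
    ∃ X : Fin n → Finset ι, Feasible F X ∧ X i = P ∧ X j = Q ∧
      ∀ k, k ≠ i → k ≠ j → X k = A k := by
  have key : ∀ R : Finset ι, R ⊆ A i ∪ A j → ∀ k, k ≠ i → k ≠ j → Disjoint R (A k) := by
    intro R hR k h1 h2
    refine Disjoint.mono_left hR ?_
    rw [disjoint_union_left]
    exact ⟨hA.2 _ _ h1.symm, hA.2 _ _ h2.symm⟩
  refine ⟨fun k => if k = i then P else if k = j then Q else A k, ⟨?_, ?_⟩, ?_, ?_, ?_⟩
  · intro k
    dsimp only
    split_ifs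
    exacts [hP, hQ, hA.1 k]
  · intro k l hkl
    dsimp only
    by_cases h1 : k = i <;> by_cases h2 : k = j <;> by_cases h3 : l = i <;> by_cases h4 : l = j <;>
      simp only [h1, h2, h3, h4, if_true, if_false, hij, hij.symm] <;> first
      | exact hd
      | exact hd.symm
      | exact key _ hPs _ h3 h4
      | exact key _ hQs _ h3 h4
      | exact (key _ hPs _ h1 h2).symm
      | exact (key _ hQs _ h1 h2).symm
      | exact hA.2 _ _ hkl
      | (exfalso; subst_vars; simp_all)
  · simp
  · simp [hij.symm]
  · intro k h1 h2; simp [h1, h2]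

theorem aux_nonneg {ι : Type*} {v : ι → ℝ} (hv : ∀ g, 0 ≤ v g) (S : Finset ι) :
    0 ≤ AddVal v S := sum_nonneg fun g _ => hv g

theorem aux_PO {ι : Type*} {n : ℕ} {F : Finset ι → Prop}
    {v : Fin n → ι → ℝ} (hv : ∀ i g, 0 ≤ v i g)
    {A : Fin n → Finset ι} (hA : MaxNSW F v A) : ParetoOpt F v A := by
  rintro ⟨X, hX, hle, j, hj⟩
  have hsub : posAgents v A ⊆ posAgents v X := by
    intro k hk
    simp only [posAgents, mem_filter, mem_univ, true_and] at hk ⊢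
    exact lt_of_lt_of_le hk (hle k)
  have heq := eq_of_subset_of_card_le hsub (hA.2.1 X hX)
  have h := hA.2.2 X hX (by rw [heq])
  have hjX : j ∈ posAgents v X := by
    simp only [posAgents, mem_filter, mem_univ, true_and]
    exact lt_of_le_of_lt (aux_nonneg (hv j) _) hj
  refine absurd h (not_le.2 ?_)
  unfold NashPos
  rw [← heq] at hjX ⊢
  refine prod_lt_prod ?_ (fun k _ => hle k) ⟨j, hjX, hj⟩
  intro k hk
  simpa [posAgents] using hk

theorem aux_prod {ι : Type*} {n : ℕ} {F : Finset ι → Prop}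
    {v : Fin n → ι → ℝ} (hv : ∀ i g, 0 ≤ v i g)
    {A X : Fin n → Finset ι} (hA : MaxNSW F v A) (hX : Feasible F X) {i j : Fin n} (hij : i ≠ j)
    (ha : 0 < AddVal (v i) (A i)) (hb : 0 < AddVal (v j) (A j))
    (hk : ∀ k, k ≠ i → k ≠ j → X k = A k) :
    AddVal (v i) (X i) * AddVal (v j) (X j) ≤ AddVal (v i) (A i) * AddVal (v j) (A j) := by
  rcases (aux_nonneg (hv i) (X i)).eq_or_lt with h1 | h1
  · rw [← h1, zero_mul]; positivity
  rcases (aux_nonneg (hv j) (X j)).eq_or_lt with h2 | h2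
  · rw [← h2, mul_zero]; positivity
  have heq : posAgents v X = posAgents v A := by
    ext k
    simp only [posAgents, mem_filter, mem_univ, true_and]
    by_cases hi : k = i
    · subst hi; simp [h1, ha]
    by_cases hj : k = j
    · subst hj; simp [h2, hb]
    rw [hk k hi hj]
  have h := hA.2.2 X hX (by rw [heq])
  unfold NashPos at h
  rw [heq] at h
  have hiA : i ∈ posAgents v A := by simpa [posAgents] using ha
  have hjA : j ∈ (posAgents v A).erase i := by
    rw [mem_erase]; exact ⟨hij.symm, by simpa [posAgents] using hb⟩
  rw [← mul_prod_erase _ _ hiA, ← mul_prod_erase _ _ hjA, ← mul_prod_erase _ _ hiA,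
    ← mul_prod_erase _ (fun k => AddVal (v k) (A k)) hjA, ← mul_assoc, ← mul_assoc] at h
  have hc : ∏ k ∈ ((posAgents v A).erase i).erase j, AddVal (v k) (X k) =
      ∏ k ∈ ((posAgents v A).erase i).erase j, AddVal (v k) (A k) := by
    refine prod_congr rfl fun k hk' => ?_
    simp only [mem_erase] at hk'
    rw [hk k hk'.2.1 hk'.1]
  rw [hc] at h
  refine le_of_mul_le_mul_right h (prod_pos fun k hk' => ?_)
  simp only [mem_erase] at hk'
  simpa [posAgents] using hk'.2.2

theorem aux_count {ι : Type*} {n : ℕ} {F : Finset ι → Prop}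
    {v : Fin n → ι → ℝ}
    {A X : Fin n → Finset ι} (hA : MaxNSW F v A) (hX : Feasible F X) {i j : Fin n}
    (ha : AddVal (v i) (A i) = 0)
    (hi : 0 < AddVal (v i) (X i)) (hj : 0 < AddVal (v j) (X j))
    (hk : ∀ k, k ≠ i → k ≠ j → X k = A k) : False := by
  have hss : posAgents v A ⊂ posAgents v X := by
    rw [ssubset_iff_of_subset]
    · refine ⟨i, ?_, ?_⟩ <;> simp [posAgents, hi, ha]
    · intro k
      simp only [posAgents, mem_filter, mem_univ, true_and]
      intro h
      by_cases h1 : k = i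
      · subst h1; exact hi
      by_cases h2 : k = j
      · subst h2; exact hj
      rwa [hk k h1 h2]
  exact absurd (hA.2.1 X hX) (not_le.2 (card_lt_card hss))

theorem aux_EF1 {ι : Type*} [DecidableEq ι] {n : ℕ}
    (F : Finset ι → Prop) (hF : IsMatroid F)
    (v : Fin n → ι → ℝ) (hv : ∀ i g, 0 ≤ v i g)
    (A : Fin n → Finset ι) (hA : MaxNSW F v A) : EF1 (1/2) v A := by
  intro i j
  have ha0 := aux_nonneg (hv i) (A i)
  have hb0 := aux_nonneg (hv j) (A j)
  by_cases hij : i = j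
  · subst hij
    exact ⟨∅, empty_subset _, by simp, by rw [sdiff_empty]; linarith⟩
  have hPO := aux_PO hv hA
  have hdij := hA.1.2 i j hij
  rcases (A j).eq_empty_or_nonempty with hT | hT
  · refine ⟨∅, empty_subset _, by simp, ?_⟩
    rw [hT]; simp only [AddVal, sdiff_empty, sum_empty, mul_zero]; exact ha0
  obtain ⟨m, hm, hmax⟩ := exists_max_image (A j) (v i) hT
  refine ⟨{m}, singleton_subset_iff.2 hm, by simp, ?_⟩
  have hTm : AddVal (v i) (A j \ {m}) = AddVal (v i) (A j) - v i m := by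
    have := sum_sdiff (f := v i) (singleton_subset_iff.2 hm)
    rw [sum_singleton] at this
    unfold AddVal; linarith
  have herase : ∀ k, ∀ g ∈ A j, AddVal (v k) ((A j).erase g) = AddVal (v k) (A j) - v k g := by
    intro k g hg
    have := sum_erase_add (A j) (v k) hg
    unfold AddVal; linarith
  obtain ⟨σ, hσ, hσd⟩ := aux_exchange hF (hA.1.1 i) (hA.1.1 j) hdij
  have hswap : ∀ g ∈ A j, ∃ X : Fin n → Finset ι, Feasible F X ∧
      AddVal (v i) (X i) = AddVal (v i) (A i) + (v i g - AddVal (v i) (σ g)) ∧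
      AddVal (v j) (X j) = AddVal (v j) (A j) - v j g ∧
      ∀ k, k ≠ i → k ≠ j → X k = A k := by
    intro g hg
    have hgi : g ∉ A i := fun h => disjoint_left.1 hdij h hg
    obtain ⟨X, hX, h1, h2, h3⟩ := aux_swap hA.1 hij (hσ g hg).2
      (hF.1.2 (erase_subset g _) (hA.1.1 j))
      (by
        rw [disjoint_left]
        intro x hx hx2
        rw [mem_erase] at hx2
        rw [mem_insert, mem_sdiff] at hx
        rcases hx with h | h
        · exact hx2.1 h
        · exact disjoint_left.1 hdij h.1 hx2.2)
      (insert_subset (mem_union_right _ hg) (sdiff_subset.trans subset_union_left))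
      ((erase_subset g _).trans subset_union_right)
    refine ⟨X, hX, ?_, ?_, h3⟩
    · rw [h1]
      have := sum_sdiff (f := v i) (hσ g hg).1
      unfold AddVal
      rw [sum_insert (fun h => hgi (mem_sdiff.1 h).1)]
      linarith
    · rw [h2, herase j g hg]
  have hsum : AddVal (v i) (A j) - AddVal (v i) (A i) ≤
      ∑ g ∈ A j, (v i g - AddVal (v i) (σ g)) := by
    rw [sum_sub_distrib]
    have h1 : ∑ g ∈ A j, AddVal (v i) (σ g) = ∑ x ∈ (A j).biUnion σ, v i x := by
      rw [sum_biUnion (fun g hg h hh hgh => hσd g hg h hh hgh)]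
      rfl
    have h2 : ∑ x ∈ (A j).biUnion σ, v i x ≤ ∑ x ∈ A i, v i x :=
      sum_le_sum_of_subset_of_nonneg (biUnion_subset.2 fun g hg => (hσ g hg).1)
        (fun x _ _ => hv i x)
    unfold AddVal at h1 ⊢
    linarith
  rcases hb0.eq_or_lt with hb | hb
  · -- agent j has value zero
    have hle : ∀ g ∈ A j, v i g - AddVal (v i) (σ g) ≤ 0 := by
      intro g hg
      by_contra hlt
      push Not at hlt
      obtain ⟨X, hX, h1, h2, h3⟩ := hswap g hg
      refine hPO ⟨X, hX, fun k => ?_, i, by linarith⟩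
      by_cases hi : k = i
      · subst hi; linarith
      by_cases hj : k = j
      · subst hj; rw [← hb]; exact aux_nonneg (hv k) _
      rw [h3 k hi hj]
    have := sum_nonpos hle
    have := hv i m
    linarith
  rcases ha0.eq_or_lt with ha | ha
  · -- agent i has value zero
    rw [← ha]
    by_contra hlt
    have hpos : 0 < ∑ g ∈ A j \ {m}, v i g := by
      have : 0 < AddVal (v i) (A j \ {m}) := by linarith
      exact this
    obtain ⟨g, hg, hgpos⟩ := exists_lt_of_sum_lt (s := A j \ {m}) (f := fun _ => (0:ℝ)) (g := v i)
      (by simpa using hpos)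
    rw [mem_sdiff, mem_singleton] at hg
    have hmpos : 0 < v i m := lt_of_lt_of_le hgpos (hmax g hg.1)
    have main : ∀ h ∈ A j, 0 < v i h → AddVal (v j) ((A j).erase h) ≤ 0 := by
      intro h hh hpos
      by_contra hc
      push Not at hc
      obtain ⟨X, hX, h1, h2, h3⟩ := aux_swap hA.1 hij
        (hF.1.2 (singleton_subset_iff.2 hh) (hA.1.1 j))
        (hF.1.2 (erase_subset h _) (hA.1.1 j)) (by simp)
        (singleton_subset_iff.2 (mem_union_right _ hh))
        ((erase_subset h _).trans subset_union_right)
      refine aux_count hA hX ha.symm ?_ ?_ h3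
      · rw [h1]; simpa [AddVal] using hpos
      · rw [h2]; exact hc
    have e1 := main g hg.1 hgpos
    have e2 := main m hm hmpos
    have e3 : v j m ≤ AddVal (v j) ((A j).erase g) :=
      single_le_sum (f := v j) (fun x _ => hv j x) (mem_erase.2 ⟨fun h => hg.2 h.symm, hm⟩)
    rw [herase j m hm] at e2
    linarith
  -- both positive
  have hstep : ∀ g ∈ A j, (v i g - AddVal (v i) (σ g)) * AddVal (v j) (A j) ≤
      v j g * (AddVal (v i) (A i) + v i m) := by
    intro g hg
    obtain ⟨X, hX, h1, h2, h3⟩ := hswap g hg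
    have h := aux_prod hv hA hX hij ha hb h3
    rw [h1, h2] at h
    have h4 : v i g - AddVal (v i) (σ g) ≤ v i m := by
      have := aux_nonneg (hv i) (σ g)
      have := hmax g hg
      linarith
    have h5 := mul_le_mul_of_nonneg_left h4 (hv j g)
    nlinarith
  have h6 := sum_le_sum hstep
  rw [← sum_mul, ← sum_mul] at h6
  have h7 : (AddVal (v i) (A j) - AddVal (v i) (A i)) * AddVal (v j) (A j) ≤
      (AddVal (v i) (A i) + v i m) * AddVal (v j) (A j) := by
    have h8 := mul_le_mul_of_nonneg_right hsum hb.le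
    have h9 : (∑ g ∈ A j, v j g) = AddVal (v j) (A j) := rfl
    rw [h9] at h6
    linarith
  have h8 := le_of_mul_le_mul_right h7 hb
  linarith

/-- Under matroid constraints, with additive (nonnegative) valuations,
every Max-NSW allocation is 1/2-EF1 and Pareto optimal. -/
theorem maxNSW_half_EF1_and_PO_under_matroid
    {ι : Type*} [DecidableEq ι] [Fintype ι] {n : ℕ}
    (F : Finset ι → Prop) (hF : IsMatroid F)
    (v : Fin n → ι → ℝ) (hv : ∀ i g, 0 ≤ v i g)
    (A : Fin n → Finset ι) (hA : MaxNSW F v A) :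
    EF1 (1/2) v A ∧ ParetoOpt F v A := by
  exact ⟨aux_EF1 F hF v hv A hA, aux_PO hv hA⟩
end

section
/- For every ε > 0, there exists an instance with two agents having additive valuations and a partition matroid constraint (in fact a uniform matroid) such that no Max-NSW allocation is (1/2 + ε)-EF1. Concretely, for a large integer k and small δ > 0, take items g_1,…,g_{2k+2} with F = {S ⊆ M : |S| ≤ k+1}, v_1(g_j) = 2k+1−δ for j ≤ k+1 and v_1(g_j) = k otherwise, v_2(g_j) = k for j ≤ k+1 and 0 otherwise; then the unique Max-NSW allocation gives {g_{k+2},…,g_{2k+2}} to agent 1 and {g_1,…,g_{k+1}} to agent 2, and agent 1's utility k(k+1) is strictly less than (1/2 + 1/(2k)) times v_1 of agent 2's bundle minus any one item. -/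
open Finset

lemma pos_univ {m : ℕ} (v : Fin 2 → Fin m → ℝ) (X : Fin 2 → Finset (Fin m))
    (h : 2 ≤ (posAgents v X).card) :
    posAgents v X = Finset.univ ∧ NashPos v X = AddVal (v 0) (X 0) * AddVal (v 1) (X 1) := by
  have h1 : posAgents v X = Finset.univ := by
    apply Finset.eq_univ_of_card
    have := Finset.card_le_univ (posAgents v X)
    simp only [Fintype.card_fin] at this ⊢
    omega
  exact ⟨h1, by rw [NashPos, h1, Fin.prod_univ_two]⟩

/-- The high items. -/
def hiItems (n : ℕ) : Finset (Fin (n + n)) := Finset.univ.filter (fun g => g.val < n)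

/-- Valuations: agent 0 has values 2 (high), 1 (low); agent 1 has values 1, 0. -/
noncomputable def hiVal (n : ℕ) (i : Fin 2) (g : Fin (n + n)) : ℝ :=
  (if i = 0 then 1 else 0) + (if g ∈ hiItems n then 1 else 0)

lemma hiItems_card (n : ℕ) : (hiItems n).card = n := by
  unfold hiItems
  rw [Fin.card_filter_val_lt]
  omega

lemma hiVal_zero (n : ℕ) (S : Finset (Fin (n + n))) :
    AddVal (hiVal n 0) S = S.card + (S ∩ hiItems n).card := by
  simp [AddVal, hiVal, Finset.sum_add_distrib]

lemma hiVal_one (n : ℕ) (S : Finset (Fin (n + n))) :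
    AddVal (hiVal n 1) S = (S ∩ hiItems n).card := by
  simp [AddVal, hiVal]

lemma inter_card_add (n : ℕ) (S T : Finset (Fin (n + n))) (h : Disjoint S T) :
    (S ∩ hiItems n).card + (T ∩ hiItems n).card ≤ n := by
  rw [← Finset.card_union_of_disjoint (h.mono Finset.inter_subset_left Finset.inter_subset_left)]
  calc _ ≤ (hiItems n).card := Finset.card_le_card
          (Finset.union_subset Finset.inter_subset_right Finset.inter_subset_right)
    _ = n := hiItems_card n

theorem exists_instance_no_maxNSW_is_half_plus_eps_EF1 :
    ∀ ε : ℝ, 0 < ε →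
      ∃ (m : ℕ) (F : Finset (Fin m) → Prop) (v : Fin 2 → Fin m → ℝ),
        (∀ i g, 0 ≤ v i g) ∧
        (∃ k : ℕ, ∀ S : Finset (Fin m), F S ↔ S.card ≤ k) ∧
        (∃ A : Fin 2 → Finset (Fin m), MaxNSW F v A) ∧
        (∀ A : Fin 2 → Finset (Fin m), MaxNSW F v A → ¬ EF1 (1/2 + ε) v A) := by
  intro ε hε
  obtain ⟨k, hk⟩ := exists_nat_gt (1 / (2 * ε))
  have hk' : 1 < 2 * ε * k := by
    rw [div_lt_iff₀ (by positivity)] at hk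
    linarith
  set n := k + 1 with hn
  let F : Finset (Fin (n + n)) → Prop := fun S => S.card ≤ n
  let B : Fin 2 → Finset (Fin (n + n)) := ![(hiItems n)ᶜ, hiItems n]
  have hB0 : B 0 = (hiItems n)ᶜ := rfl
  have hB1 : B 1 = hiItems n := rfl
  have hBc : ((hiItems n)ᶜ).card = n := by
    rw [Finset.card_compl, hiItems_card, Fintype.card_fin]; omega
  have hBF : Feasible F B := by
    refine ⟨?_, ?_⟩
    · intro i
      fin_cases i
      · exact hBc.le
      · exact (hiItems_card n).le
    · intro i j hij
      fin_cases i <;> fin_cases j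
      · exact absurd rfl hij
      · exact disjoint_compl_left
      · exact disjoint_compl_right
      · exact absurd rfl hij
  have hu0 : AddVal (hiVal n 0) (B 0) = n := by
    rw [hiVal_zero, hB0, hBc, Finset.disjoint_iff_inter_eq_empty.mp (disjoint_compl_left (a := hiItems n))]; simp
  have hu1 : AddVal (hiVal n 1) (B 1) = n := by
    rw [hiVal_one, hB1, Finset.inter_self, hiItems_card]
  have hnpos : (0 : ℝ) < n := by positivity
  have hBp : 2 ≤ (posAgents (hiVal n) B).card := by
    have : posAgents (hiVal n) B = Finset.univ := by
      ext i
      fin_cases i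
      · simpa [posAgents, hu0] using hnpos
      · simpa [posAgents, hu1] using hnpos
    rw [this]; simp
  have hBN : NashPos (hiVal n) B = n * n := by
    rw [(pos_univ _ _ hBp).2, hu0, hu1]
  have hcard : ∀ X : Fin 2 → Finset (Fin (n + n)), (posAgents (hiVal n) X).card ≤ 2 := by
    intro X
    simpa using Finset.card_le_univ (posAgents (hiVal n) X)
  refine ⟨n + n, F, hiVal n, ?_, ⟨n, fun S => Iff.rfl⟩, ⟨B, hBF, ?_, ?_⟩, ?_⟩
  · intro i g
    unfold hiVal
    positivity
  · intro X _
    exact (hcard X).trans hBp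
  · intro X hX hc
    rw [hBN, (pos_univ _ _ (hc ▸ hBp)).2, hiVal_zero, hiVal_one]
    have h1 := inter_card_add n (X 0) (X 1) (hX.2 0 1 (by decide))
    have h0 : (X 0).card ≤ n := hX.1 0
    norm_cast
    nlinarith
  · intro A hA hE
    have hAp : 2 ≤ (posAgents (hiVal n) A).card := hBp.trans (hA.2.1 B hBF)
    have hN := hA.2.2 B hBF (le_antisymm ((hcard B).trans hAp) ((hcard A).trans hBp))
    rw [hBN, (pos_univ _ _ hAp).2, hiVal_zero, hiVal_one] at hN
    have h1 := inter_card_add n (A 0) (A 1) (hA.1.2 0 1 (by decide))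
    have h0 : (A 0).card ≤ n := hA.1.1 0
    norm_cast at hN
    have ha : (A 0 ∩ hiItems n).card = 0 := by nlinarith
    have hc : (A 1 ∩ hiItems n).card = n := by
      rw [ha] at hN h1
      nlinarith
    obtain ⟨Z, -, hZ1, hZ⟩ := hE 0 1
    rw [hiVal_zero, hiVal_zero, ha] at hZ
    have h2 : n ≤ ((A 1 \ Z) ∩ hiItems n).card + 1 := by
      have : A 1 ∩ hiItems n ⊆ ((A 1 \ Z) ∩ hiItems n) ∪ Z := by
        intro x hx
        simp only [Finset.mem_union, Finset.mem_inter, Finset.mem_sdiff] at hx ⊢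
        tauto
      have := (Finset.card_le_card this).trans (Finset.card_union_le _ _)
      omega
    have h3 : ((A 1 \ Z) ∩ hiItems n).card ≤ (A 1 \ Z).card :=
      Finset.card_le_card Finset.inter_subset_left
    have h4 : (2 * k : ℝ) ≤ (A 1 \ Z).card + ((A 1 \ Z) ∩ hiItems n).card := by
      norm_cast
      omega
    have h5 : ((A 0).card : ℝ) ≤ k + 1 := by exact_mod_cast h0
    have h6 := mul_le_mul_of_nonneg_left h4 (show (0 : ℝ) ≤ 1 / 2 + ε by positivity)
    push_cast at hZ
    nlinarith
end

section
/- Fix a real constant a > 1. For any number of agents whose additive valuations are 2-valued, i.e., v_i({g}) ∈ {1, a} for every agent i and every item g, and any matroid (M, F) used as a common constraint, every Max-NSW allocation is a max{1/a², 1/2}-EF1 and Pareto optimal feasible allocation. -/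
open Finset

/-- Growing an independent set `T` with elements of an independent set `X`. -/
lemma grow_indep {ι : Type*} [DecidableEq ι] {F : Finset ι → Prop} (hF : IsMatroid F)
    {X : Finset ι} (hX : F X) (k : ℕ) : ∀ T : Finset ι, F T → X.card - T.card = k →
    ∃ T', T ⊆ T' ∧ T' ⊆ T ∪ X ∧ F T' ∧ X.card ≤ T'.card := by
  induction k with
  | zero =>
    intro T hT hk
    exact ⟨T, Subset.rfl, subset_union_left, hT, by omega⟩
  | succ k ih =>
    intro T hT hk
    obtain ⟨x, hx, hxT⟩ := hF.2 hT hX (by omega)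
    rw [mem_sdiff] at hx
    have hc : (insert x T).card = T.card + 1 := card_insert_of_notMem hx.2
    obtain ⟨T', h1, h2, h3, h4⟩ := ih (insert x T) hxT (by omega)
    refine ⟨T', (subset_insert _ _).trans h1, h2.trans ?_, h3, h4⟩
    intro z hz
    simp only [mem_union, mem_insert] at hz ⊢
    rcases hz with (rfl | h) | h
    · exact Or.inr hx.1
    · exact Or.inl h
    · exact Or.inr h

/-- One-sided exchange injection (Brualdi) through Hall's theorem. -/
lemma exchange_inj {ι : Type*} [DecidableEq ι] {F : Finset ι → Prop} (hF : IsMatroid F)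
    {X Y : Finset ι} (hX : F X) (hY : F Y) (hd : Disjoint X Y)
    (Y0 : Finset ι) (h0 : Y0 ⊆ Y) (h1 : ∀ y ∈ Y0, ¬ F (insert y X)) :
    ∃ f : Y0 → ι, Function.Injective f ∧
      ∀ y : Y0, f y ∈ X ∧ F (insert (y : ι) (X.erase (f y))) := by
  classical
  have key := (Finset.all_card_le_biUnion_card_iff_exists_injective
    (fun y : Y0 => X.filter (fun x => F (insert (y : ι) (X.erase x))))).1 ?_
  · obtain ⟨f, hf, hf2⟩ := key
    exact ⟨f, hf, fun y => by simpa using hf2 y⟩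
  intro s
  by_contra! hlt
  set N := s.biUnion (fun y : Y0 => X.filter (fun x => F (insert (y : ι) (X.erase x)))) with hN
  have hNX : N ⊆ X := by
    intro z hz
    simp only [hN, mem_biUnion, mem_filter] at hz
    obtain ⟨_, _, h, _⟩ := hz
    exact h
  have hS : F (s.map (Function.Embedding.subtype _)) := by
    refine hF.1.2 ?_ hY
    intro z hz
    simp only [mem_map, Function.Embedding.coe_subtype] at hz
    obtain ⟨w, _, rfl⟩ := hz
    exact h0 w.2
  obtain ⟨y, hy, hyN⟩ := hF.2 (hF.1.2 hNX hX) hS (by simpa using hlt)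
  simp only [mem_sdiff, mem_map, Function.Embedding.coe_subtype] at hy
  obtain ⟨⟨w, hws, rfl⟩, hwN⟩ := hy
  have hwX : (w : ι) ∉ X := fun h => (disjoint_left.1 hd h) (h0 w.2)
  obtain ⟨T, hT1, hT2, hT3, hT4⟩ := grow_indep hF hX _ _ hyN rfl
  have hT2' : T ⊆ insert (w : ι) X := by
    refine hT2.trans ?_
    intro z hz
    simp only [mem_union, mem_insert] at hz ⊢
    rcases hz with (h | h) | h
    · exact Or.inl h
    · exact Or.inr (hNX h)
    · exact Or.inr h
  have hwT : (w : ι) ∈ T := hT1 (mem_insert_self _ _)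
  have hnot : ¬ X ⊆ T := by
    intro h
    exact h1 w w.2 (hF.1.2 (insert_subset hwT h) hT3)
  obtain ⟨x, hxX, hxT⟩ := not_subset.1 hnot
  have hTsub : T ⊆ insert (w : ι) (X.erase x) := by
    intro z hz
    have := hT2' hz
    simp only [mem_insert, mem_erase] at this ⊢
    rcases this with h | h
    · exact Or.inl h
    · exact Or.inr ⟨fun e => hxT (e ▸ hz), h⟩
  have hcard : (insert (w : ι) (X.erase x)).card ≤ T.card := by
    rw [card_insert_of_notMem (fun h => hwX (mem_of_mem_erase h)), card_erase_of_mem hxX]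
    have : 0 < X.card := card_pos.2 ⟨x, hxX⟩
    omega
  have hTe := eq_of_subset_of_card_le hTsub hcard
  have hxN : x ∈ N := by
    simp only [hN, mem_biUnion, mem_filter]
    exact ⟨w, hws, hxX, hTe ▸ hT3⟩
  exact hxT (hT1 (mem_insert_of_mem hxN))

lemma exchange_gain {ι : Type*} [DecidableEq ι] {F : Finset ι → Prop} (hF : IsMatroid F)
    {X Y : Finset ι} (hX : F X) (hY : F Y) (hd : Disjoint X Y)
    (u : ι → ℝ) (hu : ∀ g, 0 ≤ u g) :
    ∃ d : ι → ℝ, AddVal u Y - AddVal u X ≤ ∑ y ∈ Y, d y ∧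
      ∀ y ∈ Y, d y ≤ u y ∧ ∃ X' : Finset ι, X' ⊆ insert y X ∧ F X' ∧ y ∈ X' ∧
        AddVal u X' = AddVal u X + d y := by
  classical
  set Y0 := Y.filter (fun y => ¬ F (insert y X)) with hY0
  obtain ⟨f, hf, hf2⟩ := exchange_inj hF hX hY hd Y0 (filter_subset _ _)
    (fun y hy => (mem_filter.1 hy).2)
  refine ⟨fun y => u y - if h : y ∈ Y0 then u (f ⟨y, h⟩) else 0, ?_, ?_⟩
  · rw [sum_sub_distrib]
    have e1 : ∑ y ∈ Y, (if h : y ∈ Y0 then u (f ⟨y, h⟩) else 0)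
        = ∑ y ∈ Y0, (if h : y ∈ Y0 then u (f ⟨y, h⟩) else 0) := by
      symm
      apply sum_subset (filter_subset _ _)
      intro x _ hx
      exact dif_neg hx
    have e2 : ∑ y ∈ Y0, (if h : y ∈ Y0 then u (f ⟨y, h⟩) else 0) = ∑ y : Y0, u (f y) := by
      rw [← sum_coe_sort Y0]
      apply sum_congr rfl
      intro y _
      simp
    have e3 : ∑ y : Y0, u (f y) ≤ ∑ x ∈ X, u x := by
      rw [← sum_image (f := u) (g := f) (s := univ) (fun a _ b _ h => hf h)]
      apply sum_le_sum_of_subset_of_nonneg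
      · intro z hz
        simp only [mem_image, mem_univ, true_and] at hz
        obtain ⟨y, rfl⟩ := hz
        exact (hf2 y).1
      · intro z _ _
        exact hu z
    unfold AddVal
    rw [e1, e2]
    linarith
  · intro y hy
    have hyX : y ∉ X := fun h => disjoint_left.1 hd h hy
    by_cases h : y ∈ Y0
    · simp only [h, dif_pos]
      refine ⟨by linarith [hu (f ⟨y, h⟩)], insert y (X.erase (f ⟨y, h⟩)), ?_,
        (hf2 ⟨y, h⟩).2, mem_insert_self _ _, ?_⟩
      · exact insert_subset_insert _ (erase_subset _ _)
      · unfold AddVal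
        rw [sum_insert (fun h => hyX (mem_of_mem_erase h)),
          ← add_sum_erase X u (hf2 ⟨y, h⟩).1]
        ring
    · simp only [h, dif_neg, not_false_eq_true]
      refine ⟨by linarith, insert y X, Subset.rfl, ?_, mem_insert_self _ _, ?_⟩
      · by_contra hc
        exact h (mem_filter.2 ⟨hy, hc⟩)
      · unfold AddVal
        rw [sum_insert hyX]
        ring

lemma nsw_two {ι : Type*} [DecidableEq ι] {n : ℕ} {F : Finset ι → Prop}
    {v : Fin n → ι → ℝ} {A : Fin n → Finset ι} (hA : MaxNSW F v A)
    {i j : Fin n} (hij : i ≠ j) {X' Y' : Finset ι} (hX : F X') (hY : F Y')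
    (hd : Disjoint X' Y') (hXs : X' ⊆ A i ∪ A j) (hYs : Y' ⊆ A i ∪ A j)
    (hpX : 0 < AddVal (v i) X') (hpY : 0 < AddVal (v j) Y') :
    0 < AddVal (v i) (A i) ∧ 0 < AddVal (v j) (A j) ∧
      AddVal (v i) X' * AddVal (v j) Y' ≤ AddVal (v i) (A i) * AddVal (v j) (A j) := by
  obtain ⟨⟨hf1, hf2⟩, hm1, hm2⟩ := hA
  set B : Fin n → Finset ι := fun k => if k = i then X' else if k = j then Y' else A k with hB
  have Bi : B i = X' := by simp [hB]
  have Bj : B j = Y' := by simp [hB, hij.symm]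
  have Bk : ∀ k, k ≠ i → k ≠ j → B k = A k := by
    intro k h1 h2
    simp [hB, h1, h2]
  have hdo : ∀ k, k ≠ i → k ≠ j → Disjoint (A i ∪ A j) (A k) := by
    intro k h1 h2
    rw [disjoint_union_left]
    exact ⟨hf2 _ _ h1.symm, hf2 _ _ h2.symm⟩
  have hBf : Feasible F B := by
    constructor
    · intro k
      by_cases h1 : k = i
      · rw [h1, Bi]; exact hX
      by_cases h2 : k = j
      · rw [h2, Bj]; exact hY
      rw [Bk k h1 h2]; exact hf1 k
    · intro k l hkl
      by_cases k1 : k = i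
      · subst k1
        rw [Bi]
        by_cases l2 : l = j
        · subst l2
          rw [Bj]; exact hd
        · rw [Bk l hkl.symm l2]
          exact (hdo l hkl.symm l2).mono_left hXs
      by_cases k2 : k = j
      · subst k2
        rw [Bj]
        by_cases l1 : l = i
        · subst l1
          rw [Bi]; exact hd.symm
        · rw [Bk l l1 hkl.symm]
          exact (hdo l l1 hkl.symm).mono_left hYs
      rw [Bk k k1 k2]
      by_cases l1 : l = i
      · subst l1
        rw [Bi]; exact ((hdo k k1 k2).mono_left hXs).symm
      by_cases l2 : l = j
      · subst l2
        rw [Bj]; exact ((hdo k k1 k2).mono_left hYs).symm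
      rw [Bk l l1 l2]
      exact hf2 k l hkl
  have hiB : i ∈ posAgents v B := by
    simp only [posAgents, mem_filter, mem_univ, true_and, Bi]; exact hpX
  have hjB : j ∈ posAgents v B := by
    simp only [posAgents, mem_filter, mem_univ, true_and, Bj]; exact hpY
  have hsub : posAgents v A ⊆ posAgents v B := by
    intro k hk
    by_cases h1 : k = i
    · rw [h1]; exact hiB
    by_cases h2 : k = j
    · rw [h2]; exact hjB
    simp only [posAgents, mem_filter, mem_univ, true_and] at hk ⊢
    rw [Bk k h1 h2]; exact hk
  have heq := eq_of_subset_of_card_le hsub (hm1 B hBf)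
  have hprod := hm2 B hBf (by rw [heq])
  have hiA := hiB
  have hjA := hjB
  rw [← heq] at hiA hjA
  refine ⟨by simpa [posAgents] using hiA, by simpa [posAgents] using hjA, ?_⟩
  unfold NashPos at hprod
  rw [← heq] at hprod
  have hj' : j ∈ (posAgents v A).erase i := mem_erase.2 ⟨hij.symm, hjA⟩
  rw [← mul_prod_erase _ _ hiA, ← mul_prod_erase _ _ hj', ← mul_prod_erase _ _ hiA,
    ← mul_prod_erase _ _ hj', Bi, Bj] at hprod
  have hc : ∏ k ∈ ((posAgents v A).erase i).erase j, AddVal (v k) (B k)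
      = ∏ k ∈ ((posAgents v A).erase i).erase j, AddVal (v k) (A k) := by
    apply prod_congr rfl
    intro k hk
    simp only [mem_erase] at hk
    rw [Bk k hk.2.1 hk.1]
  rw [hc] at hprod
  have hp : 0 < ∏ k ∈ ((posAgents v A).erase i).erase j, AddVal (v k) (A k) := by
    apply prod_pos
    intro k hk
    simp only [mem_erase, posAgents, mem_filter] at hk
    exact hk.2.2.2
  rw [← mul_assoc, ← mul_assoc] at hprod
  exact le_of_mul_le_mul_right hprod hp

/-- Under matroid constraints, with 2-valued ({1, a}, a > 1) additive
valuations, every Max-NSW allocation is max{1/a², 1/2}-EF1 and Pareto optimal. -/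
theorem maxNSW_two_valued_EF1_and_PO_under_matroid
    {ι : Type*} [DecidableEq ι] [Fintype ι] {n : ℕ}
    (a : ℝ) (ha : 1 < a)
    (F : Finset ι → Prop) (hF : IsMatroid F)
    (v : Fin n → ι → ℝ) (hv : ∀ i g, v i g = 1 ∨ v i g = a)
    (A : Fin n → Finset ι) (hA : MaxNSW F v A) :
    EF1 (max (1/a^2) (1/2)) v A ∧ ParetoOpt F v A := by
  have hv1 : ∀ i g, 1 ≤ v i g := by
    intro i g
    rcases hv i g with h | h <;> rw [h]
    exact ha.le
  have hva : ∀ i g, v i g ≤ a := by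
    intro i g
    rcases hv i g with h | h <;> rw [h]
    exact ha.le
  have hge : ∀ i S, (S.card : ℝ) ≤ AddVal (v i) S := by
    intro i S
    have := card_nsmul_le_sum S (v i) 1 (fun g _ => hv1 i g)
    simpa [AddVal] using this
  have hle : ∀ i S, AddVal (v i) S ≤ S.card * a := by
    intro i S
    have := sum_le_card_nsmul S (v i) a (fun g _ => hva i g)
    simpa [AddVal] using this
  have hnn : ∀ i S, 0 ≤ AddVal (v i) S := fun i S => (Nat.cast_nonneg _).trans (hge i S)
  have hpos : ∀ i (S : Finset ι), 0 < S.card → 0 < AddVal (v i) S := fun i S h =>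
    lt_of_lt_of_le (Nat.cast_pos.2 h) (hge i S)
  have hers : ∀ i (S : Finset ι) g, g ∈ S → AddVal (v i) (S.erase g) = AddVal (v i) S - v i g := by
    intro i S g hg
    have := add_sum_erase S (v i) hg
    unfold AddVal
    linarith
  have ha2 : 1 / a ^ 2 ≤ 1 := by
    rw [div_le_one (by positivity)]
    nlinarith
  have hA' := hA
  obtain ⟨⟨hf1, hf2⟩, hm1, hm2⟩ := hA'
  constructor
  · intro i j
    by_cases hij : i = j
    · subst hij
      refine ⟨∅, empty_subset _, by simp, ?_⟩
      have h1 : max (1 / a ^ 2) (1 / 2 : ℝ) ≤ 1 := max_le ha2 (by norm_num)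
      rw [sdiff_empty]
      nlinarith [hnn i (A i)]
    by_cases hc : (A j).card ≤ 1
    · refine ⟨A j, Subset.rfl, hc, ?_⟩
      rw [sdiff_self]
      simpa [AddVal] using hnn i (A i)
    push Not at hc
    have hd := hf2 i j hij
    have hYe : ∀ y ∈ A j, 0 < AddVal (v j) ((A j).erase y) := by
      intro y hy
      apply hpos
      rw [card_erase_of_mem hy]
      omega
    have hYF : ∀ y, F ((A j).erase y) := fun y => hF.1.2 (erase_subset _ _) (hf1 j)
    have hswap : ∀ y ∈ A j, ∀ X' : Finset ι, X' ⊆ insert y (A i) → F X' → y ∈ X' →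
        0 < AddVal (v i) (A i) ∧ 0 < AddVal (v j) (A j) ∧
        AddVal (v i) X' * (AddVal (v j) (A j) - v j y)
          ≤ AddVal (v i) (A i) * AddVal (v j) (A j) := by
      intro y hy X' hX' hFX hyX
      rw [← hers j _ y hy]
      refine nsw_two hA hij hFX (hYF y) ?_ ?_ ?_ (hpos i X' (card_pos.2 ⟨y, hyX⟩)) (hYe y hy)
      · rw [disjoint_left]
        intro z hz hz2
        rw [mem_erase] at hz2
        rcases mem_insert.1 (hX' hz) with h | h
        · exact hz2.1 h
        · exact disjoint_left.1 hd h hz2.2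
      · intro z hz
        rcases mem_insert.1 (hX' hz) with h | h
        · rw [h]; exact mem_union_right _ hy
        · exact mem_union_left _ h
      · exact (erase_subset _ _).trans subset_union_right
    have hZ : ∀ g ∈ A j, ∀ α : ℝ, α * (AddVal (v i) (A j) - v i g) ≤ AddVal (v i) (A i) →
        ∃ Z ⊆ A j, Z.card ≤ 1 ∧ AddVal (v i) (A i) ≥ α * AddVal (v i) (A j \ Z) := by
      intro g hg α h
      refine ⟨{g}, singleton_subset_iff.2 hg, by simp, ?_⟩
      rw [sdiff_singleton_eq_erase, hers i _ g hg]
      exact h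
    have hne : (A j).Nonempty := card_pos.1 (by omega)
    rcases le_total (1 / a ^ 2) (1 / 2 : ℝ) with hm | hm
    · rw [max_eq_right hm]
      obtain ⟨g, hg, hgm⟩ := exists_max_image (A j) (v i) hne
      apply hZ g hg
      obtain ⟨d, hd1, hd2⟩ := exchange_gain hF (hf1 i) (hf1 j) hd (v i)
        (fun g => zero_le_one.trans (hv1 i g))
      have hW : 0 < AddVal (v j) (A j) := hpos j _ (by omega)
      have hs : ∑ y ∈ A j, d y * AddVal (v j) (A j)
          ≤ ∑ y ∈ A j, (AddVal (v i) (A i) + v i g) * v j y := by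
        apply sum_le_sum
        intro y hy
        obtain ⟨h1, X', h2, h3, h4, h5⟩ := hd2 y hy
        obtain ⟨_, _, h6⟩ := hswap y hy X' h2 h3 h4
        rw [h5] at h6
        have h7 := hgm y hy
        have h8 := hv1 j y
        nlinarith
      rw [← sum_mul, ← mul_sum] at hs
      have := le_of_mul_le_mul_right (a := AddVal (v j) (A j)) hs hW
      linarith
    · rw [max_eq_left hm]
      have h3 : ∀ g ∈ A j, AddVal (v i) (A j) - v i g ≤ ((A j).card - 1) * a := by
        intro g hg
        have := hle i ((A j).erase g)
        rw [hers i _ g hg, card_erase_of_mem hg, Nat.cast_sub (by omega)] at this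
        simpa using this
      have hk : (2 : ℝ) ≤ (A j).card := by exact_mod_cast hc
      rcases lt_or_ge (A i).card (A j).card with hlt | hgeq
      · obtain ⟨y, hy, hyF⟩ := hF.2 (hf1 i) (hf1 j) hlt
        rw [mem_sdiff] at hy
        obtain ⟨hV, hW, h6⟩ := hswap y hy.1 _ Subset.rfl hyF (mem_insert_self _ _)
        apply hZ y hy.1
        have h5 : AddVal (v i) (insert y (A i)) = v i y + AddVal (v i) (A i) := by
          unfold AddVal
          rw [sum_insert hy.2]
        rw [h5] at h6
        have h7 := hge j ((A j).erase y)
        rw [hers j _ y hy.1, card_erase_of_mem hy.1, Nat.cast_sub (by omega)] at h7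
        push_cast at h7
        have h8 := h3 y hy.1
        have h9 := hv1 i y
        have h10 := hva j y
        rw [div_mul_eq_mul_div, one_mul, div_le_iff₀ (by positivity)]
        have h11 : ((A j).card : ℝ) - 1 ≤ AddVal (v i) (A i) * a := by
          have h12 : v i y * (AddVal (v j) (A j) - v j y) ≤ AddVal (v i) (A i) * v j y := by
            linarith
          nlinarith
        calc AddVal (v i) (A j) - v i y ≤ ((A j).card - 1) * a := h8
          _ ≤ (AddVal (v i) (A i) * a) * a := by gcongr
          _ = _ := by ring
      · obtain ⟨g, hg⟩ := hne
        apply hZ g hg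
        have h8 := h3 g hg
        have h9 := hge i (A i)
        have h10 : ((A j).card : ℝ) ≤ (A i).card := by exact_mod_cast hgeq
        rw [div_mul_eq_mul_div, one_mul, div_le_iff₀ (by positivity)]
        calc AddVal (v i) (A j) - v i g ≤ ((A j).card - 1) * a := h8
          _ ≤ AddVal (v i) (A i) * a ^ 2 := by
            apply mul_le_mul
            · linarith
            · nlinarith
            · linarith
            · exact hnn _ _
  · rintro ⟨X, hXf, hall, j, hj⟩
    have hsub : posAgents v A ⊆ posAgents v X := by
      intro k hk
      simp only [posAgents, mem_filter, mem_univ, true_and] at hk ⊢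
      exact hk.trans_le (hall k)
    have heq := eq_of_subset_of_card_le hsub (hm1 X hXf)
    have hprod := hm2 X hXf (by rw [heq])
    have hjX : j ∈ posAgents v X := by
      simp only [posAgents, mem_filter, mem_univ, true_and]
      exact (hnn j _).trans_lt hj
    refine absurd hprod (not_le.2 ?_)
    unfold NashPos
    rw [← heq]
    rw [← heq] at hjX
    apply prod_lt_prod
    · intro k hk
      simpa [posAgents] using hk
    · intro k _
      exact hall k
    · exact ⟨j, hjX, hj⟩
end

section
/- An independence system (E, F) is a matroid if and only if it is strongly 1-extendible. -/
open Finset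

/-- A strongly p-extendible system. -/
def StronglyPExtendible {ι : Type*} [DecidableEq ι] (p : ℕ) (F : Finset ι → Prop) : Prop :=
  IndepSystem F ∧
    ∀ ⦃C D H : Finset ι⦄, F C → F D → C ⊂ D → Disjoint H C → F (C ∪ H) →
      ∃ Y ⊆ D \ C, Y.card ≤ p * H.card ∧ F ((D \ Y) ∪ H)

/-- In a matroid an independent set `S` extends by elements of `D` to size at least `|D|`. -/
theorem matroid_extend {ι : Type*} [DecidableEq ι] {F : Finset ι → Prop} (hM : IsMatroid F)
    {D : Finset ι} (hD : F D) (n : ℕ) :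
    ∀ S : Finset ι, F S → D.card ≤ S.card + n →
      ∃ T, S ⊆ T ∧ T ⊆ S ∪ D ∧ F T ∧ D.card ≤ T.card := by
  induction n with
  | zero => exact fun S hS h => ⟨S, Subset.refl _, subset_union_left, hS, h⟩
  | succ n ih =>
    intro S hS h
    by_cases hlt : S.card < D.card
    · obtain ⟨x, hx, hFx⟩ := hM.2 hS hD hlt
      rw [mem_sdiff] at hx
      obtain ⟨T, h1, h2, h3, h4⟩ := ih (insert x S) hFx (by
        rw [card_insert_of_notMem hx.2]; omega)
      refine ⟨T, (subset_insert x S).trans h1, fun y hy => ?_, h3, h4⟩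
      have := h2 hy
      grind
    · exact ⟨S, Subset.refl _, subset_union_left, hS, by omega⟩

/-- An independence system is a matroid iff it is strongly 1-extendible. -/
theorem matroid_iff_strongly_one_extendible
    {ι : Type*} [DecidableEq ι] [Fintype ι]
    (F : Finset ι → Prop) (hF : IndepSystem F) :
    IsMatroid F ↔ StronglyPExtendible 1 F := by
  constructor
  · intro hM
    refine ⟨hF, fun C D H hC hD hCD hdisj hCH => ?_⟩
    obtain ⟨S, h1, h2, h3, h4⟩ := matroid_extend hM hD D.card (C ∪ H) hCH (by omega)
    have hsub := hCD.1
    refine ⟨D \ S, ?_, ?_, ?_⟩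
    · intro x hx
      grind
    · have e1 := card_sdiff_add_card_inter D S
      have e2 := card_sdiff_add_card_inter S D
      rw [inter_comm S D] at e2
      have e3 : (S \ D).card ≤ H.card := card_le_card (by
        intro x hx
        have := @h2 x
        have := @hsub x
        grind)
      omega
    · refine hF.2 ?_ h3
      intro x hx
      have := @h1 x
      grind
  · intro hS
    refine ⟨hF, fun C D hC hD hlt => ?_⟩
    have hU : C ∩ D ∪ C \ D = C := by grind
    have hss : C ∩ D ⊂ D := by
      refine ⟨inter_subset_right, fun h => ?_⟩
      have := card_le_card (h.trans inter_subset_left)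
      omega
    obtain ⟨Y, hY, hc, hFY⟩ := hS.2 (C := C ∩ D) (D := D) (H := C \ D)
      (hF.2 inter_subset_left hC) hD hss
      (disjoint_left.2 (by grind)) (by rw [hU]; exact hC)
    have hYD : Y ⊆ D := hY.trans sdiff_subset
    have e1 := card_sdiff_add_card_eq_card hYD
    have e2 : (D \ Y ∪ C \ D).card = (D \ Y).card + (C \ D).card :=
      card_union_of_disjoint (disjoint_left.2 (by grind))
    obtain ⟨x, hx, hxC⟩ := exists_mem_notMem_of_card_lt_card
      (show C.card < (D \ Y ∪ C \ D).card by omega)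
    refine ⟨x, by grind, hF.2 ?_ hFY⟩
    intro z hz
    have := @hY z
    grind
end

section
/- There exists an instance with two agents sharing one identical additive valuation assigning value 1 to every item, and a strongly 2-extendible independence system (M, F) used as a common constraint, in which the Max-NSW allocation A = (A_1, A_2) (unique up to swapping the agents) satisfies v(A_1) = (2/3) · v(A_2 \ {g}) for every g ∈ A_2; hence no Max-NSW allocation is (2/3 + ε)-EF1 for any ε > 0, and in particular Max-NSW and exact EF1 are incompatible under strongly 2-extendible system constraints. Concretely, one may take F to be the union of the power sets of {g_1,g_2}, {g_1,g_3,g_4}, {g_2,g_3,g_4}, and {g_3,g_4,g_5,g_6}, with the Max-NSW allocation A_1 = {g_1,g_2}, A_2 = {g_3,g_4,g_5,g_6}. -/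
open Finset

/-- The union of the four power sets of the concrete instance (items numbered from 0). -/
def FamF (S : Finset (Fin 6)) : Prop :=
  S ⊆ {0, 1} ∨ S ⊆ {0, 2, 3} ∨ S ⊆ {1, 2, 3} ∨ S ⊆ {2, 3, 4, 5}

instance famF_dec : DecidablePred FamF := fun S => by unfold FamF; infer_instance

theorem famF_small : ∀ D : Finset (Fin 6), FamF D → ∀ C ∈ D.powerset, 3 ≤ (D \ C).card →
    ∀ h : Fin 6, FamF (C ∪ {h}) →
      ∃ Y ∈ (D \ C).powerset, Y.card ≤ 2 ∧ FamF ((D \ Y) ∪ {h}) := by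
  decide +kernel

theorem famF_card : ∀ D : Finset (Fin 6), FamF D → D.card ≤ 4 := by
  decide +kernel

theorem famF_pair : ∀ S : Finset (Fin 6), FamF S → ∀ T : Finset (Fin 6), FamF T →
    Disjoint S T → S.card * T.card ≤ 8 ∧
      (S.card * T.card = 8 → (S.card = 2 ∧ T.card = 4) ∨ (S.card = 4 ∧ T.card = 2)) := by
  decide +kernel

theorem famF_ext : StronglyPExtendible 2 FamF := by
  refine ⟨⟨by decide, ?_⟩, ?_⟩
  · intro C D hCD hD
    rcases hD with h | h | h | h
    · exact Or.inl (hCD.trans h)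
    · exact Or.inr (Or.inl (hCD.trans h))
    · exact Or.inr (Or.inr (Or.inl (hCD.trans h)))
    · exact Or.inr (Or.inr (Or.inr (hCD.trans h)))
  · intro C D H _ hD hCD _ hCH
    by_cases hbig : (D \ C).card ≤ 2 * H.card
    · refine ⟨D \ C, Subset.rfl, hbig, ?_⟩
      rwa [Finset.sdiff_sdiff_eq_self hCD.1]
    · rcases Nat.eq_zero_or_pos H.card with h0 | h0
      · refine ⟨∅, by simp, by simp, ?_⟩
        rw [card_eq_zero] at h0
        simpa [h0] using hD
      · have h4 := famF_card D hD
        have hle : (D \ C).card ≤ D.card := card_le_card sdiff_subset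
        have h1 : H.card = 1 := by omega
        obtain ⟨h, rfl⟩ := card_eq_one.mp h1
        obtain ⟨Y, hY, hYc, hF⟩ := famF_small D hD C (mem_powerset.mpr hCD.1) (by omega) h hCH
        exact ⟨Y, mem_powerset.mp hY, by simpa using hYc, hF⟩

theorem addVal_one {ι : Type*} (S : Finset ι) : AddVal (fun _ => (1 : ℝ)) S = S.card := by
  simp [AddVal]

theorem nashPos_two (X : Fin 2 → Finset (Fin 6))
    (h : (posAgents (fun _ : Fin 2 => fun _ : Fin 6 => (1 : ℝ)) X).card = 2) :
    NashPos (fun _ : Fin 2 => fun _ : Fin 6 => (1 : ℝ)) X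
      = (((X 0).card * (X 1).card : ℕ) : ℝ) := by
  have hu : posAgents (fun _ : Fin 2 => fun _ : Fin 6 => (1 : ℝ)) X = univ := by
    rw [← card_eq_iff_eq_univ, h, Fintype.card_fin]
  unfold NashPos
  rw [hu, Fin.prod_univ_two, addVal_one, addVal_one, Nat.cast_mul]

/-- The Max-NSW allocation of the concrete instance. -/
def allocA : Fin 2 → Finset (Fin 6) := ![{0, 1}, {2, 3, 4, 5}]

theorem allocA_card_zero : (allocA 0).card = 2 := by decide

theorem allocA_card_one : (allocA 1).card = 4 := by decide

theorem allocA_pos :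
    (posAgents (fun _ : Fin 2 => fun _ : Fin 6 => (1 : ℝ)) allocA).card = 2 := by
  have hu : posAgents (fun _ : Fin 2 => fun _ : Fin 6 => (1 : ℝ)) allocA = univ := by
    unfold posAgents
    rw [filter_eq_self]
    intro i _
    rw [addVal_one]
    fin_cases i
    · simp only [Fin.zero_eta, allocA_card_zero]; norm_num
    · simp only [Fin.mk_one, allocA_card_one]; norm_num
  rw [hu]; simp

theorem allocA_nash :
    NashPos (fun _ : Fin 2 => fun _ : Fin 6 => (1 : ℝ)) allocA = 8 := by
  rw [nashPos_two _ allocA_pos, allocA_card_zero, allocA_card_one]; norm_num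

theorem allocA_feasible : Feasible FamF allocA := by
  unfold Feasible; decide

theorem pos_le_two (X : Fin 2 → Finset (Fin 6)) :
    (posAgents (fun _ : Fin 2 => fun _ : Fin 6 => (1 : ℝ)) X).card ≤ 2 := by
  simpa using card_le_univ (posAgents (fun _ : Fin 2 => fun _ : Fin 6 => (1 : ℝ)) X)

/-- A bundle of size 2 strongly envies a bundle of size 4. -/
theorem envy_aux {ε : ℝ} (hε : 0 < ε) (S T : Finset (Fin 6)) (hS : S.card = 2) (hT : T.card = 4)
    (h : ∃ Z ⊆ T, Z.card ≤ 1 ∧ AddVal (fun _ : Fin 6 => (1 : ℝ)) S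
      ≥ (2/3 + ε) * AddVal (fun _ : Fin 6 => (1 : ℝ)) (T \ Z)) : False := by
  obtain ⟨Z, hZ, hZ1, hle⟩ := h
  rw [addVal_one, addVal_one, hS] at hle
  have h3 : 3 ≤ (T \ Z).card := by rw [card_sdiff_of_subset hZ]; omega
  have h3' : (3 : ℝ) ≤ ((T \ Z).card : ℝ) := by exact_mod_cast h3
  push_cast at hle
  nlinarith

/-- There is a two-agent instance with identical all-ones valuation and
a strongly 2-extendible system in which a Max-NSW allocation A satisfies
v(A₁) = (2/3)·v(A₂ \ {g}) for every g ∈ A₂, and no Max-NSW allocation is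
(2/3+ε)-EF1 for any ε > 0 (so Max-NSW and exact EF1 are incompatible). -/
theorem exists_strongly_two_extendible_maxNSW_exactly_two_thirds_EF1 :
    ∃ (m : ℕ) (F : Finset (Fin m) → Prop) (v : Fin m → ℝ)
      (A : Fin 2 → Finset (Fin m)),
      (∀ g, v g = 1) ∧
      StronglyPExtendible 2 F ∧
      MaxNSW F (fun _ : Fin 2 => v) A ∧
      (∀ g ∈ A 1, AddVal v (A 0) = (2/3) * AddVal v ((A 1).erase g)) ∧
      (∀ ε : ℝ, 0 < ε →
        ∀ B : Fin 2 → Finset (Fin m), MaxNSW F (fun _ : Fin 2 => v) B →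
          ¬ EF1 (2/3 + ε) (fun _ : Fin 2 => v) B) := by
  refine ⟨6, FamF, fun _ => 1, allocA, fun _ => rfl, famF_ext, ?_, ?_, ?_⟩
  · refine ⟨allocA_feasible, ?_, ?_⟩
    · intro X _
      rw [allocA_pos]
      exact pos_le_two X
    · intro X hX hc
      rw [allocA_pos] at hc
      rw [allocA_nash, nashPos_two X hc]
      exact_mod_cast (famF_pair _ (hX.1 0) _ (hX.1 1) (hX.2 0 1 (by decide))).1
  · intro g hg
    rw [addVal_one, addVal_one, card_erase_of_mem hg, allocA_card_zero, allocA_card_one]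
    norm_num
  · intro ε hε B hB hEF
    obtain ⟨hBf, hBc, hBn⟩ := hB
    have h1 := hBc allocA allocA_feasible
    rw [allocA_pos] at h1
    have h2 := le_antisymm (pos_le_two B) h1
    have h3 := hBn allocA allocA_feasible (by rw [allocA_pos, h2])
    rw [allocA_nash, nashPos_two B h2] at h3
    have h4 : 8 ≤ (B 0).card * (B 1).card := by exact_mod_cast h3
    obtain ⟨h5, h6⟩ := famF_pair _ (hBf.1 0) _ (hBf.1 1) (hBf.2 0 1 (by decide))
    rcases h6 (le_antisymm h5 h4) with ⟨ha, hb⟩ | ⟨ha, hb⟩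
    · exact envy_aux hε _ _ ha hb (hEF 0 1)
    · exact envy_aux hε _ _ hb ha (hEF 1 0)
end

section
/- Fix a positive integer p. For any number of agents sharing one identical binary additive valuation v (i.e., v({g}) ∈ {0,1} for every item g) and any strongly p-extendible independence system (M, F) used as a common constraint, every Max-NSW allocation is a (1/p)-EF1 feasible allocation. -/
open Finset

/-- A Max-NSW allocation that, in addition, subject to the first two objectives,
maximizes the total number of allocated items. -/
def MaxNSWComplete {ι : Type*} {n : ℕ} (F : Finset ι → Prop) (v : Fin n → ι → ℝ)
    (A : Fin n → Finset ι) : Prop :=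
  MaxNSW F v A ∧
    ∀ X : Fin n → Finset ι, Feasible F X →
      (posAgents v X).card = (posAgents v A).card → NashPos v X = NashPos v A →
      ∑ i, (X i).card ≤ ∑ i, (A i).card

lemma AddVal_eq_card_aux {ι : Type*} [DecidableEq ι] (v : ι → ℝ) (hv : ∀ g, v g = 0 ∨ v g = 1)
    (S : Finset ι) : AddVal v S = ((S.filter (fun g => v g = 1)).card : ℝ) := by
  unfold AddVal
  rw [Finset.card_filter]
  push_cast
  refine Finset.sum_congr rfl fun g _ => ?_
  rcases hv g with h | h <;> simp [h]

/-- Under strongly p-extendible system constraints, with one identical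
binary additive valuation, every Max-NSW allocation (also maximizing the number of
allocated items as a third objective) is (1/p)-EF1. -/
theorem maxNSW_binary_inv_p_EF1_under_strongly_p_extendible
    {ι : Type*} [DecidableEq ι] [Fintype ι] {n : ℕ}
    (p : ℕ) (hp : 0 < p)
    (F : Finset ι → Prop) (hF : StronglyPExtendible p F)
    (v : ι → ℝ) (hv : ∀ g, v g = 0 ∨ v g = 1)
    (A : Fin n → Finset ι) (hA : MaxNSWComplete F (fun _ : Fin n => v) A) :
    EF1 (1/(p : ℝ)) (fun _ : Fin n => v) A := by
  obtain ⟨⟨⟨hAF, hAd⟩, hcard, hnash⟩, -⟩ := hA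
  obtain ⟨⟨hF0, hher⟩, hext⟩ := hF
  intro i j
  have hval := AddVal_eq_card_aux v hv
  set I := (A i).filter (fun g => v g = 1) with hI
  set J := (A j).filter (fun g => v g = 1) with hJ
  have hIA : I ⊆ A i := Finset.filter_subset _ _
  have hJA : J ⊆ A j := Finset.filter_subset _ _
  have hp1 : (1:ℝ) ≤ p := by exact_mod_cast hp
  by_cases hsmall : J.card ≤ p * I.card + 1
  · have key : ∃ Z ⊆ J, Z.card ≤ 1 ∧ (J \ Z).card ≤ p * I.card := by
      rcases J.eq_empty_or_nonempty with h | ⟨x, hx⟩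
      · exact ⟨∅, by simp, by simp, by simp [h]⟩
      · refine ⟨{x}, by simpa using hx, by simp, ?_⟩
        rw [Finset.card_sdiff_of_subset (by simpa using hx)]
        simp
        omega
    obtain ⟨Z, hZ, hZ1, hc⟩ := key
    refine ⟨Z, hZ.trans hJA, hZ1, ?_⟩
    have e : (A j \ Z).filter (fun g => v g = 1) = J \ Z := by
      ext g; simp [hJ]; tauto
    show AddVal v (A i) ≥ 1 / (p:ℝ) * AddVal v (A j \ Z)
    rw [hval, hval, e, ge_iff_le, one_div, inv_mul_le_iff₀ (by linarith)]
    exact_mod_cast hc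
  · exfalso
    push Not at hsmall
    have hpa : I.card ≤ p * I.card := Nat.le_mul_of_pos_left _ hp
    have hij : i ≠ j := by
      rintro rfl
      have : I = J := rfl
      rw [← this] at hsmall
      omega
    have hJF : F J := hher hJA (hAF j)
    have hIF : F I := hher hIA (hAF i)
    have hJne : J.Nonempty := Finset.card_pos.mp (by omega)
    obtain ⟨Y, hYJ, hYc, hYF⟩ := hext hF0 hJF (Finset.empty_ssubset.mpr hJne)
      (Finset.disjoint_empty_right I) (by simpa using hIF)
    rw [Finset.sdiff_empty] at hYJ
    have : (J \ Y).Nonempty := by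
      rw [← Finset.card_pos, Finset.card_sdiff_of_subset hYJ]; omega
    obtain ⟨x, hx⟩ := this
    have hxJ : x ∈ J := (Finset.mem_sdiff.mp hx).1
    have hdij := hAd i j hij
    have hxAi : x ∉ A i := fun h => Finset.disjoint_left.mp hdij h (hJA hxJ)
    have hxv : v x = 1 := (Finset.mem_filter.mp hxJ).2
    have hIx : F (insert x I) := by
      refine hher ?_ hYF
      intro g hg
      rcases Finset.mem_insert.mp hg with rfl | hg
      · exact Finset.mem_union_left _ hx
      · exact Finset.mem_union_right _ hg
    let X : Fin n → Finset ι := fun k =>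
      if k = i then insert x I else if k = j then (A j).erase x else A k
    have hXi : X i = insert x I := by simp [X]
    have hXj : X j = (A j).erase x := by simp [X, hij.symm]
    have hXk : ∀ k, k ≠ i → k ≠ j → X k = A k := fun k h1 h2 => by simp [X, h1, h2]
    have hXfe : Feasible F X := by
      refine ⟨fun k => ?_, ?_⟩
      · by_cases h1 : k = i
        · rw [h1, hXi]; exact hIx
        by_cases h2 : k = j
        · rw [h2, hXj]; exact hher (Finset.erase_subset _ _) (hAF j)
        rw [hXk k h1 h2]; exact hAF k
      · -- every moved bundle stays inside the old one, except for the item x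
        have hsub : ∀ k, ∀ g ∈ X k, (g ∈ A k ∧ g ≠ x) ∨ (g = x ∧ k = i) := by
          intro k g hg
          by_cases h1 : k = i
          · subst h1
            rw [hXi] at hg
            rcases Finset.mem_insert.mp hg with h | h
            · exact Or.inr ⟨h, rfl⟩
            · exact Or.inl ⟨hIA h, fun e => hxAi (e ▸ hIA h)⟩
          by_cases h2 : k = j
          · subst h2
            rw [hXj] at hg
            exact Or.inl ⟨Finset.mem_of_mem_erase hg, Finset.ne_of_mem_erase hg⟩
          rw [hXk k h1 h2] at hg
          refine Or.inl ⟨hg, ?_⟩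
          rintro rfl
          exact Finset.disjoint_left.mp (hAd k j h2) hg (hJA hxJ)
        intro k l hkl
        rw [Finset.disjoint_left]
        intro g hk hl
        rcases hsub k g hk with ⟨h1, h2⟩ | ⟨h1, h2⟩ <;> rcases hsub l g hl with ⟨h3, h4⟩ | ⟨h3, h4⟩
        · exact Finset.disjoint_left.mp (hAd k l hkl) h1 h3
        · exact h2 h3
        · exact h4 h1
        · exact hkl (h2.trans h4.symm)
    have vAi : AddVal v (A i) = (I.card : ℝ) := hval _
    have vAj : AddVal v (A j) = (J.card : ℝ) := hval _
    have vXi : AddVal v (X i) = (I.card : ℝ) + 1 := by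
      have hxI : x ∉ I := fun h => hxAi (hIA h)
      rw [hXi, hval]
      have : (insert x I).filter (fun g => v g = 1) = insert x I := by
        ext g; simp [hI]; rintro (rfl | h)
        · exact hxv
        · exact h.2
      rw [this, Finset.card_insert_of_notMem hxI]; push_cast; rfl
    have vXj : AddVal v (X j) = (J.card : ℝ) - 1 := by
      have h := Finset.add_sum_erase (A j) v (hJA hxJ)
      rw [hXj, ← vAj]
      unfold AddVal
      linarith
    have hJR : (I.card : ℝ) + 2 ≤ J.card := by
      have : I.card + 2 ≤ J.card := by omega
      exact_mod_cast this
    have hI0 : (0:ℝ) ≤ I.card := Nat.cast_nonneg _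
    have memA : ∀ k, k ∈ posAgents (fun _ : Fin n => v) A ↔ 0 < AddVal v (A k) := by
      intro k; simp [posAgents]
    have memX : ∀ k, k ∈ posAgents (fun _ : Fin n => v) X ↔ 0 < AddVal v (X k) := by
      intro k; simp [posAgents]
    have hPX : posAgents (fun _ : Fin n => v) X = insert i (posAgents (fun _ : Fin n => v) A) := by
      ext k
      rw [Finset.mem_insert, memA, memX]
      by_cases h1 : k = i
      · subst h1
        simp only [true_or, iff_true]
        rw [vXi]; linarith
      by_cases h2 : k = j
      · subst h2
        have h3 : 0 < AddVal v (X k) := by rw [vXj]; linarith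
        have h4 : 0 < AddVal v (A k) := by rw [vAj]; linarith
        simp [h3, h4]
      rw [hXk k h1 h2]; simp [h1]
    by_cases hiP : i ∈ posAgents (fun _ : Fin n => v) A
    · rw [Finset.insert_eq_of_mem hiP] at hPX
      have hn := hnash X hXfe (by rw [hPX])
      unfold NashPos at hn
      rw [hPX] at hn
      set P := posAgents (fun _ : Fin n => v) A with hP
      have hjP : j ∈ P.erase i := by
        rw [Finset.mem_erase, memA, vAj]
        exact ⟨hij.symm, by linarith⟩
      rw [← Finset.mul_prod_erase P _ hiP, ← Finset.mul_prod_erase P _ hiP,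
        ← Finset.mul_prod_erase (P.erase i) _ hjP, ← Finset.mul_prod_erase (P.erase i) _ hjP,
        vXi, vXj, vAi, vAj] at hn
      have heq : ∏ k ∈ (P.erase i).erase j, AddVal v (X k)
          = ∏ k ∈ (P.erase i).erase j, AddVal v (A k) := by
        refine Finset.prod_congr rfl fun k hk => ?_
        simp only [Finset.mem_erase] at hk
        rw [hXk k hk.2.1 hk.1]
      have hpos : 0 < ∏ k ∈ (P.erase i).erase j, AddVal v (A k) := by
        refine Finset.prod_pos fun k hk => ?_
        simp only [Finset.mem_erase] at hk
        exact (memA k).mp hk.2.2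
      rw [heq, ← mul_assoc, ← mul_assoc] at hn
      have := le_of_mul_le_mul_right hn hpos
      nlinarith
    · have := hcard X hXfe
      rw [hPX, Finset.card_insert_of_notMem hiP] at this
      omega
end

section
/- For every ε > 0, there exists an instance with two agents sharing one identical additive valuation and an independence system constraint such that no Max-NSW allocation is (1/4 + ε)-EF1. Concretely, for small enough δ > 0, take M = {g_1,…,g_m} with m = 1 + 1/δ, F the union of the power sets of {g_1} and of {g_2,…,g_m}, v(g_1) = 1 + δ, and v(g_k) = 4δ for all k ≥ 2; then the unique Max-NSW allocation A gives {g_1} to one agent and {g_2,…,g_m} to the other, and v(A_1) = ((1 − δ²)/4) · v(A_2 \ {g}) < (1/4) · v(A_2 \ {g}) for all g ∈ A_2. -/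
open Finset

/-- The valuation: one big item of value `k + 1`, all others of value `4`. -/
noncomputable def bigVal (k : ℕ) (g : Fin (k + 1)) : ℝ := if g = 0 then (k : ℝ) + 1 else 4

/-- The constraint: subsets of `{0}` or sets avoiding `0`. -/
def bigF (k : ℕ) (S : Finset (Fin (k + 1))) : Prop := S ⊆ {0} ∨ (0 : Fin (k + 1)) ∉ S

lemma addVal_small (k : ℕ) (S : Finset (Fin (k + 1))) (h : (0 : Fin (k + 1)) ∉ S) :
    AddVal (bigVal k) S = 4 * (S.card : ℝ) := by
  unfold AddVal
  rw [Finset.sum_congr rfl (g := fun _ => (4 : ℝ))]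
  · simp [mul_comm]
  · intro x hx
    have : x ≠ 0 := fun e => h (e ▸ hx)
    simp [bigVal, this]

lemma addVal_big (k : ℕ) : AddVal (bigVal k) {0} = (k : ℝ) + 1 := by
  simp [AddVal, bigVal]

lemma bigF_of_mem (k : ℕ) (S : Finset (Fin (k + 1))) (h : bigF k S)
    (h0 : (0 : Fin (k + 1)) ∈ S) : S = {0} := by
  rcases h with h | h
  · exact Finset.Subset.antisymm h (by simpa using h0)
  · exact absurd h0 h

lemma card_small (k : ℕ) (S : Finset (Fin (k + 1))) (h : (0 : Fin (k + 1)) ∉ S) :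
    S.card ≤ k := by
  have h1 := Finset.card_le_univ (insert 0 S)
  rw [Finset.card_insert_of_notMem h] at h1
  simp at h1
  omega

lemma pair_bound (k : ℕ) (hk : 1 ≤ k) (S T : Finset (Fin (k + 1))) (hS : bigF k S)
    (hT : bigF k T) (hd : Disjoint S T) :
    AddVal (bigVal k) S * AddVal (bigVal k) T ≤ 4 * k * (k + 1) ∧
    (4 * k * (k + 1) ≤ AddVal (bigVal k) S * AddVal (bigVal k) T →
      (S = {0} ∧ 0 ∉ T ∧ T.card = k) ∨ (T = {0} ∧ 0 ∉ S ∧ S.card = k)) := by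
  have hk' : (1 : ℝ) ≤ k := by exact_mod_cast hk
  by_cases h0 : (0 : Fin (k + 1)) ∈ S
  · have hT0 : (0 : Fin (k + 1)) ∉ T := Finset.disjoint_left.mp hd h0
    have hS' := bigF_of_mem k S hS h0
    have hc := card_small k T hT0
    have hc' : (T.card : ℝ) ≤ k := by exact_mod_cast hc
    rw [hS', addVal_big, addVal_small k T hT0]
    refine ⟨by nlinarith, fun h => Or.inl ⟨rfl, hT0, le_antisymm hc ?_⟩⟩
    have : (k : ℝ) ≤ T.card := by
      by_contra hlt
      push Not at hlt
      nlinarith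
    exact_mod_cast this
  · by_cases h1 : (0 : Fin (k + 1)) ∈ T
    · have hT' := bigF_of_mem k T hT h1
      have hc := card_small k S h0
      have hc' : (S.card : ℝ) ≤ k := by exact_mod_cast hc
      rw [hT', addVal_big, addVal_small k S h0]
      refine ⟨by nlinarith, fun h => Or.inr ⟨rfl, h0, le_antisymm hc ?_⟩⟩
      have : (k : ℝ) ≤ S.card := by
        by_contra hlt
        push Not at hlt
        nlinarith
      exact_mod_cast this
    · have hc := card_small k (S ∪ T) (by simp [h0, h1])
      rw [Finset.card_union_of_disjoint hd] at hc
      have hc' : (S.card : ℝ) + T.card ≤ k := by exact_mod_cast hc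
      rw [addVal_small k S h0, addVal_small k T h1]
      have ha : (0 : ℝ) ≤ S.card := by positivity
      have hb : (0 : ℝ) ≤ T.card := by positivity
      have key : 4 * (S.card : ℝ) * (4 * T.card) < 4 * k * (k + 1) := by
        have e1 : ((S.card : ℝ) + T.card) * ((S.card : ℝ) + T.card) ≤ k * k :=
          mul_le_mul hc' hc' (by positivity) (by positivity)
        nlinarith [sq_nonneg ((S.card : ℝ) - T.card)]
      exact ⟨key.le, fun h => absurd key (not_lt.mpr h)⟩

lemma nash_two (k : ℕ) (X : Fin 2 → Finset (Fin (k + 1)))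
    (h : (posAgents (fun _ : Fin 2 => bigVal k) X).card = 2) :
    NashPos (fun _ : Fin 2 => bigVal k) X =
      AddVal (bigVal k) (X 0) * AddVal (bigVal k) (X 1) := by
  have : posAgents (fun _ : Fin 2 => bigVal k) X = Finset.univ := by
    apply Finset.eq_univ_of_card
    simpa using h
  rw [NashPos, this, Fin.prod_univ_two]

/-- The optimal allocation. -/
def optB (k : ℕ) : Fin 2 → Finset (Fin (k + 1)) := ![{0}, Finset.univ.erase 0]

lemma optB_one (k : ℕ) : AddVal (bigVal k) (optB k 1) = 4 * k := by
  rw [addVal_small]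
  · simp [optB]
  · simp [optB]

lemma optB_zero (k : ℕ) : AddVal (bigVal k) (optB k 0) = k + 1 := addVal_big k

lemma optB_feasible (k : ℕ) : Feasible (bigF k) (optB k) := by
  refine ⟨?_, ?_⟩
  · rw [Fin.forall_fin_two]
    exact ⟨Or.inl (by simp [optB]), Or.inr (by simp [optB])⟩
  · intro i j hij
    fin_cases i <;> fin_cases j <;> simp [optB] at hij ⊢

lemma optB_card (k : ℕ) (hk : 1 ≤ k) :
    (posAgents (fun _ : Fin 2 => bigVal k) (optB k)).card = 2 := by
  have hk' : (1 : ℝ) ≤ k := by exact_mod_cast hk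
  have : posAgents (fun _ : Fin 2 => bigVal k) (optB k) = Finset.univ := by
    unfold posAgents
    rw [Finset.filter_true_of_mem]
    intro i _
    revert i
    have e0 : 0 < AddVal (bigVal k) (optB k 0) := by
      rw [optB_zero]
      linarith
    have e1 : 0 < AddVal (bigVal k) (optB k 1) := by
      rw [optB_one]
      linarith
    exact Fin.forall_fin_two.mpr ⟨fun _ => e0, fun _ => e1⟩
  rw [this]
  simp

lemma posAgents_le (k : ℕ) (X : Fin 2 → Finset (Fin (k + 1))) :
    (posAgents (fun _ : Fin 2 => bigVal k) X).card ≤ 2 := by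
  simpa using Finset.card_le_univ (posAgents (fun _ : Fin 2 => bigVal k) X)

lemma optB_max (k : ℕ) (hk : 1 ≤ k) :
    MaxNSW (bigF k) (fun _ : Fin 2 => bigVal k) (optB k) := by
  refine ⟨optB_feasible k, ?_, ?_⟩
  · intro X _
    rw [optB_card k hk]
    exact posAgents_le k X
  · intro X hX hc
    rw [optB_card k hk] at hc
    rw [nash_two k X hc, nash_two k _ (optB_card k hk), optB_zero, optB_one]
    have := (pair_bound k hk (X 0) (X 1) (hX.1 0) (hX.1 1) (hX.2 0 1 (by decide))).1
    linarith

lemma not_ef1_aux (k : ℕ) (ε : ℝ) (hε : 0 < ε) (hkε : 2 < 4 * ε * ((k : ℝ) - 1))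
    (T Z : Finset (Fin (k + 1))) (hT : 0 ∉ T) (hc : T.card = k) (hZ : Z ⊆ T)
    (hZc : Z.card ≤ 1) :
    AddVal (bigVal k) {0} < (1 / 4 + ε) * AddVal (bigVal k) (T \ Z) := by
  rw [addVal_big, addVal_small k (T \ Z) (fun h => hT (Finset.mem_sdiff.mp h).1)]
  have h1 : k ≤ (T \ Z).card + 1 := by
    rw [Finset.card_sdiff_of_subset hZ]
    omega
  have h2 : (k : ℝ) - 1 ≤ (T \ Z).card := by
    have : (k : ℝ) ≤ (T \ Z).card + 1 := by exact_mod_cast h1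
    linarith
  nlinarith

/-- For every ε > 0 there is a two-agent instance with one identical
additive (nonnegative) valuation and an independence system constraint in which a
Max-NSW allocation exists but no Max-NSW allocation is (1/4 + ε)-EF1. -/
theorem exists_instance_no_maxNSW_is_quarter_plus_eps_EF1 :
    ∀ ε : ℝ, 0 < ε →
      ∃ (m : ℕ) (F : Finset (Fin m) → Prop) (v : Fin m → ℝ),
        (∀ g, 0 ≤ v g) ∧
        IndepSystem F ∧
        (∃ A : Fin 2 → Finset (Fin m), MaxNSW F (fun _ : Fin 2 => v) A) ∧
        (∀ A : Fin 2 → Finset (Fin m), MaxNSW F (fun _ : Fin 2 => v) A →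
          ¬ EF1 (1/4 + ε) (fun _ : Fin 2 => v) A) := by
  intro ε hε
  obtain ⟨k, hk⟩ := exists_nat_gt (1 + 1 / (2 * ε))
  have hp : 0 < 1 / (2 * ε) := by positivity
  have hk1 : 1 ≤ k := by
    have : (1 : ℝ) < k := by linarith
    exact_mod_cast this.le
  have hkε : 2 < 4 * ε * ((k : ℝ) - 1) := by
    have h1 : 1 / (2 * ε) < (k : ℝ) - 1 := by linarith
    rw [div_lt_iff₀ (by positivity)] at h1
    linarith
  refine ⟨k + 1, bigF k, bigVal k, ?_, ?_, ⟨optB k, optB_max k hk1⟩, ?_⟩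
  · intro g
    unfold bigVal
    split_ifs <;> positivity
  · refine ⟨Or.inr (by simp), ?_⟩
    intro C D hCD hD
    rcases hD with h | h
    · exact Or.inl (hCD.trans h)
    · exact Or.inr (fun h' => h (hCD h'))
  · intro A hA hEF
    obtain ⟨hf, hcard, hmax⟩ := hA
    have hc : (posAgents (fun _ : Fin 2 => bigVal k) A).card = 2 := by
      apply le_antisymm (posAgents_le k A)
      exact (optB_card k hk1).symm.le.trans (hcard _ (optB_feasible k))
    have hm := hmax _ (optB_feasible k) (by rw [hc, optB_card k hk1])
    rw [nash_two k A hc, nash_two k _ (optB_card k hk1), optB_zero, optB_one] at hm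
    rcases (pair_bound k hk1 (A 0) (A 1) (hf.1 0) (hf.1 1) (hf.2 0 1 (by decide))).2
      (by linarith) with ⟨h0, h1, h2⟩ | ⟨h0, h1, h2⟩
    · obtain ⟨Z, hZ, hZc, hle⟩ := hEF 0 1
      have := not_ef1_aux k ε hε hkε (A 1) Z h1 h2 hZ hZc
      rw [← h0] at this
      exact absurd this (not_lt.mpr hle)
    · obtain ⟨Z, hZ, hZc, hle⟩ := hEF 1 0
      have := not_ef1_aux k ε hε hkε (A 0) Z h1 h2 hZ hZc
      rw [← h0] at this
      exact absurd this (not_lt.mpr hle)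
end

section
/- For any number of agents with general additive valuations and any independence system (M, F) used as a common constraint, every Max-NSW allocation is a 1/4-EF1 and Pareto optimal feasible allocation. -/
open Finset

/-- Derandomized splitting lemma: some split of `B` does at least as well as the uniform average. -/
lemma exists_good_split {ι : Type*} [DecidableEq ι] (w u : ι → ℝ) (B : Finset ι) :
    ∀ a b : ℝ, ∃ S ⊆ B,
      (2 * a + ∑ g ∈ B, w g) * (2 * b + ∑ g ∈ B, u g) - ∑ g ∈ B, w g * u g ≤
        4 * ((a + ∑ g ∈ S, w g) * (b + ∑ g ∈ B \ S, u g)) := by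
  induction B using Finset.induction_on with
  | empty =>
    intro a b
    exact ⟨∅, Finset.Subset.refl _, by simp; linarith⟩
  | insert e B he ih =>
    intro a b
    obtain ⟨S, hS, h1⟩ := ih (a + w e) b
    obtain ⟨T, hT, h2⟩ := ih a (b + u e)
    have heS : e ∉ S := fun h => he (hS h)
    have heT : e ∉ T := fun h => he (hT h)
    have hd1 : insert e B \ insert e S = B \ S := by
      ext x; simp only [Finset.mem_sdiff, Finset.mem_insert]
      by_cases hx : x = e
      · subst hx; simp [he]
      · simp [hx]
    have hd2 : insert e B \ T = insert e (B \ T) := Finset.insert_sdiff_of_notMem _ heT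
    have heBT : e ∉ B \ T := fun h => he (Finset.mem_sdiff.1 h).1
    rw [Finset.sum_insert he, Finset.sum_insert he, Finset.sum_insert he]
    by_cases hc : (2 * a + (w e + ∑ g ∈ B, w g)) * (2 * b + (u e + ∑ g ∈ B, u g)) -
        (w e * u e + ∑ g ∈ B, w g * u g) ≤
        4 * ((a + w e + ∑ g ∈ S, w g) * (b + ∑ g ∈ B \ S, u g))
    · refine ⟨insert e S, Finset.insert_subset_insert _ hS, ?_⟩
      rw [hd1, Finset.sum_insert heS]
      linarith
    · refine ⟨T, hT.trans (Finset.subset_insert _ _), ?_⟩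
      rw [hd2, Finset.sum_insert heBT]
      push Not at hc
      nlinarith

lemma feasible_split {ι : Type*} [DecidableEq ι] {n : ℕ}
    (F : Finset ι → Prop) (hF : IndepSystem F) (A : Fin n → Finset ι) (hA : Feasible F A)
    (i j : Fin n) (hij : i ≠ j) (S T : Finset ι) (hS : S ⊆ A j) (hT : T ⊆ A j)
    (hST : Disjoint S T) :
    Feasible F (Function.update (Function.update A i S) j T) := by
  obtain ⟨h1, h2⟩ := hA
  have key : ∀ k, k ≠ i → k ≠ j → Function.update (Function.update A i S) j T k = A k := by
    intro k hi hj; simp [hi, hj]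
  have ki : Function.update (Function.update A i S) j T i = S := by simp [hij]
  have kj : Function.update (Function.update A i S) j T j = T := by simp
  generalize Function.update (Function.update A i S) j T = X at *
  have hSk : ∀ k, k ≠ j → Disjoint S (A k) := fun k hk =>
    Finset.disjoint_of_subset_left hS (h2 j k hk.symm)
  have hTk : ∀ k, k ≠ j → Disjoint T (A k) := fun k hk =>
    Finset.disjoint_of_subset_left hT (h2 j k hk.symm)
  constructor
  · intro k
    by_cases hj : k = j
    · subst hj; rw [kj]; exact hF.2 hT (h1 _)
    by_cases hi : k = i
    · subst hi; rw [ki]; exact hF.2 hS (h1 _)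
    rw [key k hi hj]; exact h1 k
  · intro k l hkl
    by_cases hj : k = j
    · subst hj
      rw [kj]
      by_cases hi : l = i
      · subst hi; rw [ki]; exact hST.symm
      · rw [key l hi hkl.symm]; exact hTk l hkl.symm
    by_cases hi : k = i
    · subst hi
      rw [ki]
      by_cases hj' : l = j
      · subst hj'; rw [kj]; exact hST
      · rw [key l hkl.symm hj']; exact hSk l hj'
    rw [key k hi hj]
    by_cases hj' : l = j
    · subst hj'; rw [kj]; exact (hTk k hj).symm
    by_cases hi' : l = i
    · subst hi'; rw [ki]; exact (hSk k hj).symm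
    rw [key l hi' hj']; exact h2 k l hkl

lemma posAgents_eq_of_subset {ι : Type*} {n : ℕ}
    (F : Finset ι → Prop) (v : Fin n → ι → ℝ)
    (A : Fin n → Finset ι) (hA : MaxNSW F v A) (X : Fin n → Finset ι) (hX : Feasible F X)
    (h : posAgents v A ⊆ posAgents v X) : posAgents v A = posAgents v X :=
  Finset.eq_of_subset_of_card_le h (hA.2.1 X hX)

lemma mem_posAgents {ι : Type*} {n : ℕ} (v : Fin n → ι → ℝ) (X : Fin n → Finset ι) (i : Fin n) :
    i ∈ posAgents v X ↔ 0 < AddVal (v i) (X i) := by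
  simp [posAgents]

lemma maxNSW_pareto {ι : Type*} {n : ℕ}
    (F : Finset ι → Prop) (v : Fin n → ι → ℝ) (hv : ∀ i g, 0 ≤ v i g)
    (A : Fin n → Finset ι) (hA : MaxNSW F v A) : ParetoOpt F v A := by
  rintro ⟨X, hX, hle, j, hj⟩
  have hsub : posAgents v A ⊆ posAgents v X := by
    intro k hk
    rw [mem_posAgents] at *
    exact hk.trans_le (hle k)
  have heq := posAgents_eq_of_subset F v A hA X hX hsub
  have hn := hA.2.2 X hX (by rw [heq])
  have h0 : 0 ≤ AddVal (v j) (A j) := Finset.sum_nonneg fun g _ => hv j g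
  have hjA : j ∈ posAgents v A := by
    rw [heq, mem_posAgents]; exact h0.trans_lt hj
  have : NashPos v A < NashPos v X := by
    unfold NashPos
    rw [← heq]
    exact Finset.prod_lt_prod (fun k hk => (mem_posAgents v A k).1 hk) (fun k _ => hle k)
      ⟨j, hjA, hj⟩
  linarith

/-- Replacing bundles of two positive agents cannot increase their product. -/
lemma maxNSW_two {ι : Type*} [DecidableEq ι] {n : ℕ}
    (F : Finset ι → Prop) (hF : IndepSystem F) (v : Fin n → ι → ℝ)
    (A : Fin n → Finset ι) (hA : MaxNSW F v A)
    (i j : Fin n) (hij : i ≠ j) (S T : Finset ι) (hS : S ⊆ A j) (hT : T ⊆ A j)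
    (hST : Disjoint S T) (hi : 0 < AddVal (v i) S) (hj : 0 < AddVal (v j) T) :
    0 < AddVal (v i) (A i) ∧
    (0 < AddVal (v j) (A j) → AddVal (v i) S * AddVal (v j) T ≤
      AddVal (v i) (A i) * AddVal (v j) (A j)) := by
  have hX := feasible_split F hF A hA.1 i j hij S T hS hT hST
  have key : ∀ k, k ≠ i → k ≠ j → Function.update (Function.update A i S) j T k = A k := by
    intro k hi hj; simp [hi, hj]
  have ki : Function.update (Function.update A i S) j T i = S := by simp [hij]
  have kj : Function.update (Function.update A i S) j T j = T := by simp
  generalize Function.update (Function.update A i S) j T = X at *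
  have hsub : posAgents v A ⊆ posAgents v X := by
    intro k hk
    rw [mem_posAgents] at *
    by_cases h1 : k = i
    · subst h1; rwa [ki]
    by_cases h2 : k = j
    · subst h2; rwa [kj]
    rwa [key k h1 h2]
  have heq := posAgents_eq_of_subset F v A hA X hX hsub
  have hiA : i ∈ posAgents v A := by rw [heq, mem_posAgents, ki]; exact hi
  refine ⟨(mem_posAgents v A i).1 hiA, fun hjpos => ?_⟩
  have hjA : j ∈ (posAgents v A).erase i :=
    Finset.mem_erase.2 ⟨hij.symm, (mem_posAgents v A j).2 hjpos⟩
  have hn := hA.2.2 X hX (by rw [heq])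
  unfold NashPos at hn
  rw [← heq, ← Finset.mul_prod_erase _ _ hiA, ← Finset.mul_prod_erase _ _ hiA,
    ← Finset.mul_prod_erase _ _ hjA, ← Finset.mul_prod_erase _ _ hjA, ki, kj] at hn
  have hrest : ∏ k ∈ ((posAgents v A).erase i).erase j, AddVal (v k) (X k) =
      ∏ k ∈ ((posAgents v A).erase i).erase j, AddVal (v k) (A k) := by
    refine Finset.prod_congr rfl fun k hk => ?_
    simp only [Finset.mem_erase] at hk
    rw [key k hk.2.1 hk.1]
  have hpos : 0 < ∏ k ∈ ((posAgents v A).erase i).erase j, AddVal (v k) (A k) := by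
    refine Finset.prod_pos fun k hk => ?_
    simp only [Finset.mem_erase] at hk
    exact (mem_posAgents v A k).1 hk.2.2
  rw [hrest, ← mul_assoc, ← mul_assoc] at hn
  exact le_of_mul_le_mul_right hn hpos

/-- Under independence system constraints, with additive
(nonnegative) valuations, every Max-NSW allocation is 1/4-EF1 and Pareto optimal. -/
theorem maxNSW_quarter_EF1_and_PO_under_indep_system
    {ι : Type*} [DecidableEq ι] [Fintype ι] {n : ℕ}
    (F : Finset ι → Prop) (hF : IndepSystem F)
    (v : Fin n → ι → ℝ) (hv : ∀ i g, 0 ≤ v i g)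
    (A : Fin n → Finset ι) (hA : MaxNSW F v A) :
    EF1 (1/4) v A ∧ ParetoOpt F v A := by
  have hP := maxNSW_pareto F v hv A hA
  refine ⟨?_, hP⟩
  have nn : ∀ k S, 0 ≤ AddVal (v k) S := fun k S => Finset.sum_nonneg fun g _ => hv k g
  intro i j
  by_cases hij : i = j
  · subst hij
    refine ⟨∅, by simp, by simp, ?_⟩
    have := nn i (A i)
    simp only [Finset.sdiff_empty]
    linarith
  by_cases hj : AddVal (v j) (A j) = 0
  · refine ⟨∅, by simp, by simp, ?_⟩
    simp only [Finset.sdiff_empty]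
    by_contra hc
    have h0 := nn i (A j)
    refine hP ⟨_, feasible_split F hF A hA.1 i j hij (A j) ∅ (Finset.Subset.refl _) (by simp)
      (by simp), fun k => ?_, i, ?_⟩
    · by_cases hkj : k = j
      · subst hkj; rw [hj]; exact nn _ _
      by_cases hki : k = i
      · subst hki
        simp only [Function.update_of_ne hkj, Function.update_self]
        linarith
      · simp [hkj, hki]
    · simp only [Function.update_of_ne hij, Function.update_self]
      linarith
  have hjpos : 0 < AddVal (v j) (A j) := lt_of_le_of_ne (nn _ _) (Ne.symm hj)
  by_cases hi : AddVal (v i) (A i) = 0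
  · obtain ⟨k, hk, hkpos⟩ : ∃ k ∈ A j, 0 < v j k := by
      by_contra hc
      push Not at hc
      exact absurd (Finset.sum_nonpos hc) (not_le.2 hjpos)
    refine ⟨{k}, by simpa using hk, by simp, ?_⟩
    by_contra hc
    have := (maxNSW_two F hF v A hA i j hij (A j \ {k}) {k} Finset.sdiff_subset (by simpa using hk)
      Finset.sdiff_disjoint (by linarith) (by simpa [AddVal] using hkpos)).1
    linarith
  have hipos : 0 < AddVal (v i) (A i) := lt_of_le_of_ne (nn _ _) (Ne.symm hi)
  by_contra hc
  push Not at hc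
  obtain ⟨S, hS, hs⟩ := exists_good_split (v i) (v j) (A j) 0 0
  simp only [mul_zero, zero_add] at hs
  have hne : (A j).Nonempty := by
    by_contra he
    rw [Finset.not_nonempty_iff_eq_empty] at he
    rw [he] at hjpos
    simp [AddVal] at hjpos
  have hg : ∀ g ∈ A j, 4 * AddVal (v i) (A i) < (∑ x ∈ A j, v i x) - v i g := by
    intro g hg
    have h := hc {g} (by simpa using hg) (by simp)
    have h2 : AddVal (v i) (A j \ {g}) = (∑ x ∈ A j, v i x) - v i g := by
      unfold AddVal
      rw [Finset.sdiff_singleton_eq_erase, ← Finset.add_sum_erase _ _ hg]; ring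
    rw [h2] at h
    linarith
  have hsum : 4 * AddVal (v i) (A i) * AddVal (v j) (A j) <
      (∑ g ∈ A j, v i g) * (∑ g ∈ A j, v j g) - ∑ g ∈ A j, v i g * v j g := by
    rw [Finset.mul_sum, ← Finset.sum_sub_distrib]
    unfold AddVal at hjpos ⊢
    rw [Finset.mul_sum]
    obtain ⟨k, hk, hkpos⟩ : ∃ k ∈ A j, 0 < v j k := by
      by_contra hc
      push Not at hc
      exact absurd (Finset.sum_nonpos hc) (not_le.2 hjpos)
    refine Finset.sum_lt_sum (fun g hg' => ?_) ⟨k, hk, ?_⟩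
    · rw [← sub_mul]
      exact mul_le_mul_of_nonneg_right (hg g hg').le (hv j g)
    · rw [← sub_mul]
      exact mul_lt_mul_of_pos_right (hg k hk) hkpos
  have hlt : AddVal (v i) (A i) * AddVal (v j) (A j) <
      AddVal (v i) S * AddVal (v j) (A j \ S) := by
    unfold AddVal at *
    linarith
  have hpp : 0 < AddVal (v i) S * AddVal (v j) (A j \ S) := (mul_pos hipos hjpos).trans hlt
  have h1 : 0 < AddVal (v i) S := pos_of_mul_pos_left hpp (nn _ _)
  have h2 : 0 < AddVal (v j) (A j \ S) := pos_of_mul_pos_right hpp (nn _ _)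
  have := (maxNSW_two F hF v A hA i j hij S (A j \ S) hS Finset.sdiff_subset
    Finset.disjoint_sdiff h1 h2).2 hjpos
  linarith
end

section
/- Fix a positive integer p. For any number of agents sharing one identical binary additive valuation (i.e., all agents share one additive valuation v with v({g}) ∈ {0,1} for every item g) and any strongly p-extendible independence system (M, F) used as a common constraint, every Max-NSW allocation is a max{1/p, 1/4}-EF1 and Pareto optimal feasible allocation. -/
open Finset

lemma AddVal_eq_card {ι : Type*} (v : ι → ℝ) (hv : ∀ g, v g = 0 ∨ v g = 1) (S : Finset ι) :
    AddVal v S = ((S.filter (fun g => v g = 1)).card : ℝ) := by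
  unfold AddVal
  rw [Finset.card_filter]
  push_cast
  refine Finset.sum_congr rfl fun g _ => ?_
  rcases hv g with h | h <;> simp [h]

lemma AddVal_of_one {ι : Type*} (v : ι → ℝ) (S : Finset ι) (h : ∀ g ∈ S, v g = 1) :
    AddVal v S = (S.card : ℝ) := by
  unfold AddVal
  rw [Finset.sum_congr rfl h]
  simp

/-- Replacing the bundles of two agents in a Max-NSW allocation. -/
lemma swap_bound {ι : Type*} [DecidableEq ι] {n : ℕ} (F : Finset ι → Prop) (v : ι → ℝ)
    (hv0 : ∀ S : Finset ι, 0 ≤ AddVal v S)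
    (A : Fin n → Finset ι) (hA : MaxNSW F (fun _ : Fin n => v) A)
    (i j : Fin n) (hij : i ≠ j) (S T : Finset ι) (hS : F S) (hT : F T) (hST : Disjoint S T)
    (hS' : S ⊆ A i ∪ A j) (hT' : T ⊆ A i ∪ A j)
    (hSpos : 0 < AddVal v S) (hTpos : 0 < AddVal v T) (hj : 0 < AddVal v (A j)) :
    0 < AddVal v (A i) ∧ AddVal v S * AddVal v T ≤ AddVal v (A i) * AddVal v (A j) := by
  obtain ⟨⟨hAF, hAd⟩, hcard, hprod⟩ := hA
  let X : Fin n → Finset ι := fun k => if k = i then S else if k = j then T else A k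
  have hXi : X i = S := by simp [X]
  have hXj : X j = T := by simp [X, hij.symm]
  have hXk : ∀ k, k ≠ i → k ≠ j → X k = A k := fun k h1 h2 => by simp [X, h1, h2]
  have hout : ∀ k, k ≠ i → k ≠ j → Disjoint (A i ∪ A j) (A k) := fun k h1 h2 =>
    Finset.disjoint_union_left.2 ⟨hAd _ _ h1.symm, hAd _ _ h2.symm⟩
  have hXf : Feasible F X := by
    constructor
    · intro k
      by_cases h1 : k = i
      · subst h1; rwa [hXi]
      · by_cases h2 : k = j
        · subst h2; rwa [hXj]
        · rw [hXk k h1 h2]; exact hAF k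
    · intro k l hkl
      by_cases h1 : k = i
      · subst h1
        rw [hXi]
        by_cases h2 : l = j
        · subst h2; rwa [hXj]
        · rw [hXk l hkl.symm h2]
          exact (hout l hkl.symm h2).mono_left hS'
      · by_cases h2 : k = j
        · subst h2
          rw [hXj]
          by_cases h3 : l = i
          · subst h3; rw [hXi]; exact hST.symm
          · rw [hXk l h3 hkl.symm]
            exact (hout l h3 hkl.symm).mono_left hT'
        · rw [hXk k h1 h2]
          by_cases h3 : l = i
          · subst h3; rw [hXi]; exact ((hout k h1 h2).mono_left hS').symm
          · by_cases h4 : l = j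
            · subst h4; rw [hXj]; exact ((hout k h1 h2).mono_left hT').symm
            · rw [hXk l h3 h4]; exact hAd _ _ hkl
  have hpos : posAgents (fun _ : Fin n => v) X
      = insert i (posAgents (fun _ : Fin n => v) A) := by
    ext k
    simp only [posAgents, Finset.mem_insert, Finset.mem_filter, Finset.mem_univ, true_and]
    by_cases h1 : k = i
    · subst h1; simp [hXi, hSpos]
    · by_cases h2 : k = j
      · subst h2; simp [hXj, hTpos, hj]
      · simp [hXk k h1 h2, h1]
  have hi : i ∈ posAgents (fun _ : Fin n => v) A := by
    by_contra hi
    have := hcard X hXf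
    rw [hpos, Finset.card_insert_of_notMem hi] at this
    omega
  rw [Finset.insert_eq_of_mem hi] at hpos
  have hle := hprod X hXf (by rw [hpos])
  have hjm : j ∈ posAgents (fun _ : Fin n => v) A := by simp [posAgents, hj]
  have hjm' : j ∈ (posAgents (fun _ : Fin n => v) A).erase i := by simp [hjm, hij.symm]
  refine ⟨by simpa [posAgents] using hi, ?_⟩
  unfold NashPos at hle
  rw [hpos, ← Finset.mul_prod_erase _ _ hi, ← Finset.mul_prod_erase _ _ hi,
    ← Finset.mul_prod_erase _ _ hjm', ← Finset.mul_prod_erase _ _ hjm', hXi, hXj] at hle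
  have hrest : ∏ k ∈ ((posAgents (fun _ : Fin n => v) A).erase i).erase j, AddVal v (X k)
      = ∏ k ∈ ((posAgents (fun _ : Fin n => v) A).erase i).erase j, AddVal v (A k) := by
    refine Finset.prod_congr rfl fun k hk => ?_
    simp only [Finset.mem_erase] at hk
    rw [hXk k hk.2.1 hk.1]
  rw [hrest, ← mul_assoc, ← mul_assoc] at hle
  refine le_of_mul_le_mul_right hle (Finset.prod_pos fun k hk => ?_)
  simp only [Finset.mem_erase, posAgents, Finset.mem_filter] at hk
  exact hk.2.2.2

lemma maxNSW_po {ι : Type*} {n : ℕ} (F : Finset ι → Prop) (v : Fin n → ι → ℝ)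
    (A : Fin n → Finset ι) (hA : MaxNSW F v A) (hv0 : ∀ i S, 0 ≤ AddVal (v i) S) :
    ParetoOpt F v A := by
  obtain ⟨-, hcard, hprod⟩ := hA
  rintro ⟨X, hX, hle, j, hj⟩
  have hsub : posAgents v A ⊆ posAgents v X := by
    intro k hk
    simp only [posAgents, Finset.mem_filter, Finset.mem_univ, true_and] at hk ⊢
    exact hk.trans_le (hle k)
  have heq := Finset.eq_of_subset_of_card_le hsub (hcard X hX)
  have hjX : j ∈ posAgents v X := by
    simp only [posAgents, Finset.mem_filter, Finset.mem_univ, true_and]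
    exact (hv0 _ _).trans_lt hj
  have h := hprod X hX (by rw [heq])
  refine absurd h (not_le.2 ?_)
  unfold NashPos
  rw [← heq] at hjX ⊢
  refine Finset.prod_lt_prod (fun k hk => ?_) (fun k _ => hle k) ⟨j, hjX, hj⟩
  simpa [posAgents] using hk

lemma nat_half (a b : ℕ) (h : (b / 2) * (b - b / 2) ≤ a * b) : b ≤ 4 * a + 1 := by
  obtain ⟨c, hc | hc⟩ := Nat.even_or_odd' b
  · subst hc
    have h1 : 2 * c / 2 = c := by omega
    have h2 : 2 * c - c = c := by omega
    rw [h1, h2] at h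
    nlinarith
  · subst hc
    have h1 : (2 * c + 1) / 2 = c := by omega
    have h2 : 2 * c + 1 - c = c + 1 := by omega
    rw [h1, h2] at h
    nlinarith

lemma nat_bounds {ι : Type*} [DecidableEq ι] {n : ℕ}
    (p : ℕ) (hp : 0 < p)
    (F : Finset ι → Prop) (hF : StronglyPExtendible p F)
    (v : ι → ℝ) (hv : ∀ g, v g = 0 ∨ v g = 1)
    (A : Fin n → Finset ι) (hA : MaxNSW F (fun _ : Fin n => v) A) (i j : Fin n) (hij : i ≠ j) :
    ((A j).filter (fun g => v g = 1)).card ≤ p * ((A i).filter (fun g => v g = 1)).card + 1 ∧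
    ((A j).filter (fun g => v g = 1)).card ≤ 4 * ((A i).filter (fun g => v g = 1)).card + 1 := by
  have hv0 : ∀ S : Finset ι, 0 ≤ AddVal v S := fun S => by
    rw [AddVal_eq_card v hv]; positivity
  have hsw := swap_bound F v hv0 A hA i j hij
  have hi := AddVal_eq_card v hv (A i)
  have hj := AddVal_eq_card v hv (A j)
  rw [hi, hj] at hsw
  obtain ⟨⟨-, hsubF⟩, hext⟩ := hF
  obtain ⟨⟨hAF, hAd⟩, -⟩ := hA
  have hIs : (A i).filter (fun g => v g = 1) ⊆ A i := Finset.filter_subset _ _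
  have hJs : (A j).filter (fun g => v g = 1) ⊆ A j := Finset.filter_subset _ _
  have hI1 : ∀ g ∈ (A i).filter (fun g => v g = 1), v g = 1 := by simp
  have hJ1 : ∀ g ∈ (A j).filter (fun g => v g = 1), v g = 1 := by simp
  generalize (A i).filter (fun g => v g = 1) = I at *
  generalize (A j).filter (fun g => v g = 1) = J at *
  have hIF : F I := hsubF hIs (hAF i)
  have hJF : F J := hsubF hJs (hAF j)
  have hd : Disjoint I J := (hAd i j hij).mono hIs hJs
  -- natural number form of the swap lemma
  have key : ∀ S T : Finset ι, F S → F T → Disjoint S T → S ⊆ I ∪ J → T ⊆ I ∪ J →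
      0 < S.card → 0 < T.card → 0 < J.card → 0 < I.card ∧ S.card * T.card ≤ I.card * J.card := by
    intro S T hS hT hST hS' hT' h1 h2 h3
    have hone : ∀ g ∈ I ∪ J, v g = 1 := by
      intro g hg
      rcases Finset.mem_union.1 hg with h | h
      · exact hI1 g h
      · exact hJ1 g h
    have hSv := AddVal_of_one v S fun g hg => hone g (hS' hg)
    have hTv := AddVal_of_one v T fun g hg => hone g (hT' hg)
    have hu := Finset.union_subset_union hIs hJs
    have := hsw S T hS hT hST (hS'.trans hu) (hT'.trans hu)
      (by rw [hSv]; exact_mod_cast h1) (by rw [hTv]; exact_mod_cast h2) (by exact_mod_cast h3)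
    rw [hSv, hTv] at this
    exact_mod_cast this
  constructor
  · by_contra hcon
    push Not at hcon
    have hJne : (∅ : Finset ι) ⊂ J := by
      rw [Finset.empty_ssubset, ← Finset.card_pos]; omega
    obtain ⟨Y, hY, hYc, hYF⟩ := hext (hsubF (Finset.empty_subset J) hJF) hJF hJne
      (Finset.disjoint_empty_right I) (by simpa using hIF)
    have hc : 0 < (J \ Y).card := by
      have := Finset.le_card_sdiff Y J
      omega
    obtain ⟨x, hx⟩ := Finset.card_pos.1 hc
    have hxJ : x ∈ J := (Finset.mem_sdiff.1 hx).1
    have hxI : x ∉ I := fun h => Finset.disjoint_left.1 hd h hxJ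
    have hap : I.card ≤ p * I.card := Nat.le_mul_of_pos_left _ hp
    have h := key (insert x I) (J.erase x)
      (hsubF (Finset.insert_subset (Finset.mem_union_left _ hx) Finset.subset_union_right) hYF)
      (hsubF (Finset.erase_subset _ _) hJF)
      (by
        rw [Finset.disjoint_insert_left]
        exact ⟨by simp, hd.mono_right (Finset.erase_subset _ _)⟩)
      (Finset.insert_subset (Finset.mem_union_right _ hxJ) Finset.subset_union_left)
      ((Finset.erase_subset _ _).trans Finset.subset_union_right)
      (by simp)
      (by rw [Finset.card_erase_of_mem hxJ]; omega) (by omega)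
    rw [Finset.card_insert_of_notMem hxI, Finset.card_erase_of_mem hxJ] at h
    obtain ⟨m, hm⟩ : ∃ m, J.card = m + 1 := ⟨J.card - 1, by omega⟩
    rw [hm] at h hcon
    simp only [Nat.add_sub_cancel] at h
    nlinarith [h.2]
  · by_cases hb : J.card ≤ 1
    · omega
    obtain ⟨S, hSJ, hSc⟩ := Finset.exists_subset_card_eq (show J.card / 2 ≤ J.card by omega)
    have hTc : (J \ S).card = J.card - J.card / 2 := by
      rw [Finset.card_sdiff_of_subset hSJ, hSc]
    have h := key S (J \ S) (hsubF hSJ hJF) (hsubF Finset.sdiff_subset hJF)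
      Finset.disjoint_sdiff (hSJ.trans Finset.subset_union_right)
      (Finset.sdiff_subset.trans Finset.subset_union_right) (by omega) (by omega) (by omega)
    rw [hTc, hSc] at h
    exact nat_half _ _ h.2

/-- Under strongly p-extendible system constraints, with one identical
binary additive valuation, every Max-NSW allocation (also maximizing the number of
allocated items as a third objective) is max{1/p, 1/4}-EF1 and Pareto optimal. -/
theorem maxNSW_binary_max_inv_p_quarter_EF1_PO_under_strongly_p_extendible
    {ι : Type*} [DecidableEq ι] [Fintype ι] {n : ℕ}
    (p : ℕ) (hp : 0 < p)
    (F : Finset ι → Prop) (hF : StronglyPExtendible p F)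
    (v : ι → ℝ) (hv : ∀ g, v g = 0 ∨ v g = 1)
    (A : Fin n → Finset ι) (hA : MaxNSWComplete F (fun _ : Fin n => v) A) :
    EF1 (max (1/(p : ℝ)) (1/4)) (fun _ : Fin n => v) A ∧
      ParetoOpt F (fun _ : Fin n => v) A := by
  have hv0 : ∀ S : Finset ι, 0 ≤ AddVal v S := fun S => by
    rw [AddVal_eq_card v hv]; positivity
  refine ⟨?_, maxNSW_po F _ A hA.1 fun _ S => hv0 S⟩
  have hp1 : (1 : ℝ) ≤ p := by exact_mod_cast hp
  intro i j
  by_cases hij : i = j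
  · subst hij
    refine ⟨∅, Finset.empty_subset _, by simp, ?_⟩
    have hα : max (1/(p : ℝ)) (1/4) ≤ 1 :=
      max_le ((div_le_one (by linarith)).2 hp1) (by norm_num)
    rw [Finset.sdiff_empty]
    exact mul_le_of_le_one_left (hv0 _) hα
  obtain ⟨h1, h2⟩ := nat_bounds p hp F hF v hv A hA.1 i j hij
  have hi := AddVal_eq_card v hv (A i)
  by_cases hJ : ((A j).filter (fun g => v g = 1)).card = 0
  · refine ⟨∅, Finset.empty_subset _, by simp, ?_⟩
    have hj := AddVal_eq_card v hv (A j)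
    rw [hJ] at hj
    simp only [Finset.sdiff_empty, hj]
    simpa using hv0 (A i)
  · obtain ⟨x, hx⟩ := Finset.card_pos.1 (Nat.pos_of_ne_zero hJ)
    obtain ⟨hxA, hx1⟩ := Finset.mem_filter.1 hx
    refine ⟨{x}, by simpa using hxA, by simp, ?_⟩
    have hj : AddVal v (A j \ {x}) = ((A j).filter (fun g => v g = 1)).card - 1 := by
      rw [← AddVal_eq_card v hv]
      unfold AddVal
      rw [Finset.sdiff_singleton_eq_erase, ← Finset.add_sum_erase _ _ hxA, hx1]
      ring
    show AddVal v (A i) ≥ _ * AddVal v (A j \ {x})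
    rw [hj, hi]
    have hb : (0 : ℝ) ≤ ((A j).filter (fun g => v g = 1)).card - 1 := by
      have : (1 : ℝ) ≤ ((A j).filter (fun g => v g = 1)).card := by
        exact_mod_cast Nat.pos_of_ne_zero hJ
      linarith
    have h1' : (((A j).filter (fun g => v g = 1)).card : ℝ)
        ≤ p * ((A i).filter (fun g => v g = 1)).card + 1 := by exact_mod_cast h1
    have h2' : (((A j).filter (fun g => v g = 1)).card : ℝ)
        ≤ 4 * ((A i).filter (fun g => v g = 1)).card + 1 := by exact_mod_cast h2
    rw [max_mul_of_nonneg _ _ hb]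
    refine max_le ?_ (by linarith)
    rw [div_mul_eq_mul_div, div_le_iff₀ (by linarith)]
    linarith
end

section
/- For any number of agents with lexicographic preferences (each agent i has a strict total preference order π_i on the items, and compares bundles lexicographically) and any independence system (M, F) used as a common constraint, there exists a feasible allocation that is exactly EF1 and Pareto optimal with respect to the lexicographic bundle preferences (namely, the allocation computed by the round-robin procedure in which, in each round, each agent in turn receives her most-preferred remaining item whose addition keeps her bundle independent, being skipped if no such item exists). -/
open Finset

/-- Strict lexicographic preference between bundles induced by a strict total
order `r` on items (`r g h` meaning `g` is strictly preferred to `h`):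
`X ≻ Y` iff the most-preferred item of the symmetric difference lies in `X`. -/
def LexStrict {ι : Type*} [DecidableEq ι] (r : ι → ι → Prop) (X Y : Finset ι) : Prop :=
  ∃ g ∈ (X \ Y) ∪ (Y \ X), g ∈ X ∧ ∀ h ∈ (X \ Y) ∪ (Y \ X), h ≠ g → r g h

/-- Weak lexicographic preference: strict preference or equality. -/
def LexWeak {ι : Type*} [DecidableEq ι] (r : ι → ι → Prop) (X Y : Finset ι) : Prop :=
  LexStrict r X Y ∨ X = Y

/-- Exact EF1 for lexicographic preferences: for all agents i, j, either j's bundle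
is empty or removing some item g from it makes i weakly prefer her own bundle. -/
def LexEF1 {ι : Type*} [DecidableEq ι] {n : ℕ} (r : Fin n → ι → ι → Prop)
    (A : Fin n → Finset ι) : Prop :=
  ∀ i j : Fin n, A j = ∅ ∨ ∃ g ∈ A j, LexWeak (r i) (A i) ((A j).erase g)

/-- Pareto optimality with respect to lexicographic preferences. -/
def LexPO {ι : Type*} [DecidableEq ι] {n : ℕ} (F : Finset ι → Prop)
    (r : Fin n → ι → ι → Prop) (A : Fin n → Finset ι) : Prop :=
  ¬ ∃ X : Fin n → Finset ι, Feasible F X ∧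
      (∀ i, LexWeak (r i) (X i) (A i)) ∧
      ∃ j, LexStrict (r j) (X j) (A j)

lemma exists_best {ι : Type*} [Fintype ι] (r : ι → ι → Prop) (hr : IsStrictTotalOrder ι r)
    (S : Set ι) (hS : S.Nonempty) : ∃ m ∈ S, ∀ h ∈ S, h ≠ m → r m h := by
  have := hr
  have wf : WellFounded r := Finite.wellFounded_of_trans_of_irrefl r
  obtain ⟨m, hm, hmin⟩ := wf.has_min S hS
  refine ⟨m, hm, fun h hh hne => ?_⟩
  rcases trichotomous_of r m h with h1 | h1 | h1
  · exact h1
  · exact absurd h1.symm hne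
  · exact absurd h1 (hmin h hh)

lemma lexWeak_of {ι : Type*} [DecidableEq ι] [Fintype ι] (r : ι → ι → Prop)
    (hr : IsStrictTotalOrder ι r) (A B : Finset ι)
    (h : ∀ b ∈ B, b ∉ A → ∃ a ∈ A, a ∉ B ∧ r a b) : LexWeak r A B := by
  have := hr
  by_cases hAB : A = B
  · exact Or.inr hAB
  left
  have hne : (((A \ B) ∪ (B \ A) : Finset ι) : Set ι).Nonempty := by
    rw [Finset.coe_nonempty, Finset.nonempty_iff_ne_empty]
    intro he
    apply hAB
    ext x
    have : x ∉ (A \ B) ∪ (B \ A) := by simp [he]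
    simp only [Finset.mem_union, Finset.mem_sdiff] at this
    tauto
  obtain ⟨m, hm, hbest⟩ := exists_best r hr _ hne
  refine ⟨m, hm, ?_, fun x hx => hbest x hx⟩
  by_contra hmA
  have hmB : m ∈ B := by
    simp at hm
    tauto
  obtain ⟨a, ha, haB, hra⟩ := h m hmB hmA
  have h2 := hbest a (by simp; tauto) (by rintro rfl; exact hmA ha)
  exact irrefl_of r a (trans_of r hra h2)

/-- Partial allocations all of whose choices are forced for any dominating allocation. -/
def Forced {ι : Type*} {n : ℕ} (F : Finset ι → Prop)
    (r : Fin n → ι → ι → Prop) (A : Fin n → Finset ι) : Prop :=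
  Feasible F A ∧ ∀ X, Feasible F X →
    (∀ i, ∀ g ∈ A i, g ∉ X i → ∃ h ∈ X i, h ∉ A i ∧ r i h g) → ∀ i, A i ⊆ X i

/-- Item `g` is unallocated and can be added to the bundle of `i`. -/
def Pickable {ι : Type*} [DecidableEq ι] {n : ℕ} (F : Finset ι → Prop)
    (A : Fin n → Finset ι) (i : Fin n) (g : ι) : Prop :=
  (∀ j, g ∉ A j) ∧ F (insert g (A i))

lemma Forced.pick {ι : Type*} [DecidableEq ι] [Fintype ι] {n : ℕ}
    {r : Fin n → ι → ι → Prop} (hr : ∀ i, IsStrictTotalOrder ι (r i))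
    {F : Finset ι → Prop} (hF : IndepSystem F) {A : Fin n → Finset ι}
    (hA : Forced F r A) (i : Fin n) (hp : ∃ g, Pickable F A i g) :
    ∃ g, Pickable F A i g ∧ (∀ h, Pickable F A i h → h ≠ g → r i g h) ∧
      Forced F r (Function.update A i (insert g (A i))) := by
  obtain ⟨g, hg, hbest⟩ := exists_best (r i) (hr i) {g | Pickable F A i g} hp
  have := hr i
  refine ⟨g, hg, hbest, ⟨?_, ?_⟩, ?_⟩
  · intro j
    by_cases hj : j = i
    · subst hj; simpa using hg.2
    · simpa [hj] using hA.1.1 j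
  · intro j k hjk
    have hd := hA.1.2 j k hjk
    have g1 := hg.1
    by_cases hj : j = i
    · subst hj
      simp [hjk.symm, g1, hd]
    · by_cases hk : k = i
      · subst hk
        simp [hj, g1, hd]
      · simpa [hj, hk] using hd
  · intro X hX hdom
    have hsub : ∀ j, A j ⊆ Function.update A i (insert g (A i)) j := by
      intro j
      by_cases hj : j = i
      · subst hj; simp
      · simp [hj]
    have hAX := hA.2 X hX (by
      intro j x hx hxX
      obtain ⟨h, h1, h2, h3⟩ := hdom j x (hsub j hx) hxX
      exact ⟨h, h1, fun h' => h2 (hsub j h'), h3⟩)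
    intro j
    by_cases hj : j = i
    · subst hj
      rw [Function.update_self]
      refine Finset.insert_subset ?_ (hAX j)
      by_contra hgX
      obtain ⟨h, h1, h2, h3⟩ := hdom j g (by simp) hgX
      rw [Function.update_self] at h2
      have hpick : Pickable F A j h := by
        refine ⟨fun k hk => ?_, hF.2 (Finset.insert_subset h1 (hAX j)) (hX.1 j)⟩
        by_cases hkj : k = j
        · subst hkj; exact h2 (Finset.mem_insert_of_mem hk)
        · exact (Finset.disjoint_left.1 (hX.2 k j hkj)) (hAX k hk) h1
      have h4 := hbest h hpick (by rintro rfl; simp at h2)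
      exact irrefl_of (r j) h (trans_of (r j) h3 h4)
    · simpa [hj] using hAX j

/-- Agent `i` holds an item better than every unallocated independent item. -/
def TopHeld {ι : Type*} {n : ℕ} (F : Finset ι → Prop)
    (r : Fin n → ι → ι → Prop) (A : Fin n → Finset ι) (i : Fin n) : Prop :=
  ∀ h, (∀ j, h ∉ A j) → F {h} → ∃ a ∈ A i, r i a h

lemma TopHeld.mono {ι : Type*} [DecidableEq ι] {n : ℕ} {F : Finset ι → Prop}
    {r : Fin n → ι → ι → Prop} {A B : Fin n → Finset ι} {i : Fin n}
    (hA : TopHeld F r A i) (hAB : ∀ j, A j ⊆ B j) : TopHeld F r B i := by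
  intro h h1 h2
  obtain ⟨a, ha, hr⟩ := hA h (fun j hj => h1 j (hAB j hj)) h2
  exact ⟨a, hAB i ha, hr⟩

lemma sub_update {ι : Type*} [DecidableEq ι] {n : ℕ} (A : Fin n → Finset ι) (i : Fin n) (g : ι) :
    ∀ j, A j ⊆ Function.update A i (insert g (A i)) j := by
  intro j
  by_cases hj : j = i
  · subst hj; simp
  · simp [hj]

/-- The first round of round robin. -/
lemma phase_one {ι : Type*} [DecidableEq ι] [Fintype ι] {n : ℕ}
    {r : Fin n → ι → ι → Prop} (hr : ∀ i, IsStrictTotalOrder ι (r i))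
    {F : Finset ι → Prop} (hF : IndepSystem F) (S : Finset (Fin n)) :
    ∃ A, Forced F r A ∧ (∀ i ∈ S, TopHeld F r A i) ∧ (∀ i, i ∉ S → A i = ∅) ∧
      ∀ i, ∀ g ∈ A i, ∀ h ∈ A i, h = g := by
  induction S using Finset.induction_on with
  | empty =>
    refine ⟨fun _ => ∅, ⟨⟨fun _ => hF.1, by simp⟩, by simp⟩, by simp, by simp, by simp⟩
  | insert i S hi ih =>
    obtain ⟨A, hA, hT, hE, hU⟩ := ih
    have hAi := hE i hi
    by_cases hp : ∃ g, Pickable F A i g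
    · obtain ⟨g, hg, hbest, hB⟩ := hA.pick hr hF i hp
      refine ⟨_, hB, ?_, ?_, ?_⟩
      · intro j hj
        rcases Finset.mem_insert.1 hj with rfl | hj
        · intro h h1 h2
          refine ⟨g, by simp, hbest h ⟨fun k hk => h1 k (sub_update A j g k hk), ?_⟩ ?_⟩
          · simpa [hAi] using h2
          · rintro rfl
            exact h1 j (by simp)
        · exact (hT j hj).mono (sub_update A i g)
      · intro j hj
        simp only [Finset.mem_insert, not_or] at hj
        simpa [hj.1] using hE j hj.2
      · intro j
        by_cases hj : j = i
        · subst hj; simp [hAi]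
        · simpa [hj] using hU j
    · refine ⟨A, hA, ?_, ?_, hU⟩
      · intro j hj
        rcases Finset.mem_insert.1 hj with rfl | hj
        · intro h h1 h2
          exact absurd ⟨h, h1, by simpa [hAi] using h2⟩ hp
        · exact hT j hj
      · intro j hj
        simp only [Finset.mem_insert, not_or] at hj
        exact hE j hj.2

/-- Envy invariant: except for one item, every item of `j` is beaten by some item of `i`. -/
def EnvyInv {ι : Type*} [DecidableEq ι] {n : ℕ}
    (r : Fin n → ι → ι → Prop) (A : Fin n → Finset ι) : Prop :=
  ∀ i j, i ≠ j → A j = ∅ ∨ ∃ g ∈ A j, ∀ h ∈ (A j).erase g, ∃ a ∈ A i, r i a h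

/-- The remaining rounds. -/
lemma phase_two {ι : Type*} [DecidableEq ι] [Fintype ι] {n : ℕ}
    {r : Fin n → ι → ι → Prop} (hr : ∀ i, IsStrictTotalOrder ι (r i))
    {F : Finset ι → Prop} (hF : IndepSystem F) (m : ℕ) :
    ∀ A, Forced F r A → (∀ i, TopHeld F r A i) → EnvyInv r A →
      (Finset.univ.filter (fun x => ∀ j, x ∉ A j)).card ≤ m →
      ∃ B, Forced F r B ∧ EnvyInv r B ∧ ∀ i g, ¬ Pickable F B i g := by
  induction m with
  | zero =>
    intro A hA _ hE hc
    refine ⟨A, hA, hE, fun i g hg => ?_⟩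
    have : g ∈ (Finset.univ.filter (fun x => ∀ j, x ∉ A j)) := by simpa using hg.1
    rw [Finset.card_eq_zero.1 (Nat.le_zero.1 hc)] at this
    simp at this
  | succ m ih =>
    intro A hA hT hE hc
    by_cases hp : ∃ i g, Pickable F A i g
    · obtain ⟨i, hp⟩ := hp
      obtain ⟨g, hg, hbest, hB⟩ := hA.pick hr hF i hp
      have hsub := sub_update A i g
      refine ih _ hB (fun j => (hT j).mono hsub) ?_ ?_
      · intro k j hkj
        by_cases hj : j = i
        · subst hj
          right
          have hFg : F {g} := hF.2 (by simp) hg.2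
          obtain ⟨a, ha, hra⟩ := hT k g hg.1 hFg
          simp only [Function.update_self, Function.update_of_ne hkj]
          rcases hE k j hkj with h0 | ⟨g0, hg0, h0⟩
          · exact ⟨g, by simp, by simp [h0]⟩
          · refine ⟨g0, Finset.mem_insert_of_mem hg0, fun h hh => ?_⟩
            simp only [Finset.mem_erase, Finset.mem_insert] at hh
            rcases hh with ⟨h1, rfl | h2⟩
            · exact ⟨a, ha, hra⟩
            · exact h0 h (Finset.mem_erase.2 ⟨h1, h2⟩)
        · rw [Function.update_of_ne hj]
          rcases hE k j hkj with h0 | ⟨g0, hg0, h0⟩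
          · exact Or.inl h0
          · refine Or.inr ⟨g0, hg0, fun h hh => ?_⟩
            obtain ⟨a, ha, hra⟩ := h0 h hh
            exact ⟨a, hsub k ha, hra⟩
      · refine Nat.lt_succ_iff.1 (lt_of_lt_of_le (Finset.card_lt_card ?_) hc)
        refine Finset.ssubset_iff_subset_ne.2 ⟨?_, ?_⟩
        · intro x hx
          simp only [Finset.mem_filter, Finset.mem_univ, true_and] at hx ⊢
          exact fun j hj => hx j (hsub j hj)
        · intro he
          have h1 : g ∈ (Finset.univ.filter (fun x => ∀ j, x ∉ A j)) := by simpa using hg.1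
          rw [← he] at h1
          simp only [Finset.mem_filter, Finset.mem_univ, true_and] at h1
          exact h1 i (by simp)
    · exact ⟨A, hA, hE, fun i g hg => hp ⟨i, g, hg⟩⟩

/-- For agents with lexicographic preferences (each induced by a
strict total order on the items) and any independence system constraint, there is
a feasible allocation that is exactly EF1 and Pareto optimal for these
preferences (e.g., the one produced by the modified round-robin procedure). -/
theorem exists_lex_EF1_and_PO_under_indep_system
    {ι : Type*} [DecidableEq ι] [Fintype ι] {n : ℕ}
    (r : Fin n → ι → ι → Prop) (hr : ∀ i, IsStrictTotalOrder ι (r i))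
    (F : Finset ι → Prop) (hF : IndepSystem F) :
    ∃ A : Fin n → Finset ι, Feasible F A ∧ LexEF1 r A ∧ LexPO F r A := by
  obtain ⟨A₀, h0, hT, -, hU⟩ := phase_one hr hF Finset.univ
  have hE0 : EnvyInv r A₀ := by
    intro i j _
    rcases (A₀ j).eq_empty_or_nonempty with h | ⟨g, hg⟩
    · exact Or.inl h
    · refine Or.inr ⟨g, hg, fun h hh => ?_⟩
      rw [Finset.mem_erase] at hh
      exact absurd (hU j g hg h hh.2) hh.1
  obtain ⟨A, hA, hE, hmax⟩ := phase_two hr hF _ A₀ h0 (fun i => hT i (Finset.mem_univ i)) hE0 le_rfl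
  refine ⟨A, hA.1, ?_, ?_⟩
  · intro i j
    by_cases hij : i = j
    · subst hij
      rcases (A i).eq_empty_or_nonempty with h | ⟨g, hg⟩
      · exact Or.inl h
      · refine Or.inr ⟨g, hg, lexWeak_of _ (hr i) _ _ fun b hb hb' => ?_⟩
        exact absurd (Finset.mem_of_mem_erase hb) hb'
    · rcases hE i j hij with h | ⟨g, hg, h⟩
      · exact Or.inl h
      · refine Or.inr ⟨g, hg, lexWeak_of _ (hr i) _ _ fun b hb _ => ?_⟩
        obtain ⟨a, ha, hra⟩ := h b hb
        exact ⟨a, ha, fun h' => Finset.disjoint_left.1 (hA.1.2 i j hij) ha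
          (Finset.mem_of_mem_erase h'), hra⟩
  · rintro ⟨X, hX, hw, j, g, hg, hgX, -⟩
    have hAX := hA.2 X hX (by
      intro i g hg hgX
      rcases hw i with ⟨h, h1, h2, h3⟩ | h
      · have hgh : g ≠ h := by rintro rfl; exact hgX h2
        have := h3 g (by simp; tauto) hgh
        refine ⟨h, h2, ?_, this⟩
        simp at h1
        tauto
      · exact absurd (h ▸ hg) hgX)
    have hgA : g ∉ A j := by
      simp at hg
      tauto
    refine hmax j g ⟨fun k hk => ?_, hF.2 (Finset.insert_subset hgX (hAX j)) (hX.1 j)⟩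
    by_cases hkj : k = j
    · subst hkj; exact hgA hk
    · exact Finset.disjoint_left.1 (hX.2 k j hkj) (hAX k hk) hgX
end
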